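/- The replica-symmetric free energy of the SK model on the Nishimori line satisfies: lim_{L→∞} (1/L^d) E[log Z_L^{SK}] = ∫ Dy log 2cosh(β√q y + β²q) + (β²/4)(1−q)² − β²q²/2, where q is the solution of q = ∫ Dy tanh(β√q y + β²q) and Dy is the standard Gaussian measure. -/

import Mathlib

open MeasureTheory ProbabilityTheory Filter Topology

/-- The Ising spin value of a configuration at a site. -/
noncomputable def spin {N : ℕ} (σ : Fin N → Bool) (i : Fin N) : ℝ :=
  if σ i then 1 else -1

/-- The replica-symmetric free-energy functional on the Nishimori line. -/
noncomputable def rsFunctional (β q : ℝ) : ℝ :=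
  (∫ y, Real.log (2 * Real.cosh (β * Real.sqrt q * y + β ^ 2 * q))
      ∂(gaussianReal 0 1))
    + β ^ 2 / 4 * (1 - q) ^ 2 - β ^ 2 * q ^ 2 / 2


/-- Standard Gaussian product measure. -/
noncomputable abbrev gpi (ι : Type*) [Fintype ι] : Measure (ι → ℝ) :=
  Measure.pi fun _ => gaussianReal 0 1

/-- Gibbs average. -/
noncomputable def gib {S : Type*} [Fintype S] (h f : S → ℝ) : ℝ :=
  (∑ σ, Real.exp (h σ) * f σ) / ∑ σ, Real.exp (h σ)

section gibbs
variable {S : Type*} [Fintype S]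

lemma Z_pos [Nonempty S] (h : S → ℝ) : 0 < ∑ σ, Real.exp (h σ) :=
  Finset.sum_pos (fun _ _ => Real.exp_pos _) Finset.univ_nonempty

lemma gib_mono [Nonempty S] (h : S → ℝ) {f g : S → ℝ} (hfg : ∀ σ, f σ ≤ g σ) :
    gib h f ≤ gib h g := by
  unfold gib
  have := Z_pos h
  gcongr
  exact hfg _

lemma gib_const [Nonempty S] (h : S → ℝ) (c : ℝ) : gib h (fun _ => c) = c := by
  unfold gib
  have := Z_pos h
  rw [← Finset.sum_mul]; field_simp

lemma gib_add (h f g : S → ℝ) : gib h (fun σ => f σ + g σ) = gib h f + gib h g := by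
  unfold gib
  simp only [mul_add, Finset.sum_add_distrib, add_div]

lemma gib_sub (h f g : S → ℝ) : gib h (fun σ => f σ - g σ) = gib h f - gib h g := by
  unfold gib
  simp only [mul_sub, Finset.sum_sub_distrib, sub_div]

lemma gib_mul (h : S → ℝ) (c : ℝ) (f : S → ℝ) : gib h (fun σ => c * f σ) = c * gib h f := by
  unfold gib
  simp only [mul_left_comm _ c, ← Finset.mul_sum, mul_div_assoc]

lemma gib_sum {ι : Type*} (s : Finset ι) (h : S → ℝ) (f : ι → S → ℝ) :
    gib h (fun σ => ∑ p ∈ s, f p σ) = ∑ p ∈ s, gib h (f p) := by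
  unfold gib
  simp only [Finset.mul_sum]
  rw [Finset.sum_comm, Finset.sum_div]

lemma gib_abs_le [Nonempty S] (h f : S → ℝ) (C : ℝ) (hf : ∀ σ, |f σ| ≤ C) : |gib h f| ≤ C := by
  rw [abs_le]
  constructor
  · rw [← gib_const h (-C)]; exact gib_mono h fun σ => (abs_le.1 (hf σ)).1
  · rw [← gib_const h C]; exact gib_mono h fun σ => (abs_le.1 (hf σ)).2

/-- Two-replica average. -/
lemma gib_mul_gib (h f g : S → ℝ) :
    gib h f * gib h g = gib h (fun σ => gib h (fun τ => f σ * g τ)) := by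
  simp only [gib_mul]
  rw [mul_comm, ← gib_mul]
  congr 1; ext σ; ring

lemma hasDerivAt_logZ [Nonempty S] {h : ℝ → S → ℝ} {h' : S → ℝ} {x : ℝ}
    (hh : ∀ σ, HasDerivAt (fun y => h y σ) (h' σ) x) :
    HasDerivAt (fun y => Real.log (∑ σ, Real.exp (h y σ))) (gib (h x) h') x := by
  have h1 : HasDerivAt (fun y => ∑ σ, Real.exp (h y σ)) (∑ σ, Real.exp (h x σ) * h' σ) x := by
    convert! HasDerivAt.fun_sum (u := Finset.univ) (fun σ _ => (hh σ).exp) using 1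
  exact h1.log (Z_pos _).ne'

lemma hasDerivAt_gib [Nonempty S] {h : ℝ → S → ℝ} {h' : S → ℝ} {x : ℝ} (f : S → ℝ)
    (hh : ∀ σ, HasDerivAt (fun y => h y σ) (h' σ) x) :
    HasDerivAt (fun y => gib (h y) f)
      (gib (h x) (fun σ => f σ * h' σ) - gib (h x) f * gib (h x) h') x := by
  have h1 : HasDerivAt (fun y => ∑ σ, Real.exp (h y σ)) (∑ σ, Real.exp (h x σ) * h' σ) x := by
    convert! HasDerivAt.fun_sum (u := Finset.univ) (fun σ _ => (hh σ).exp) using 1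
  have h2 : HasDerivAt (fun y => ∑ σ, Real.exp (h y σ) * f σ)
      (∑ σ, Real.exp (h x σ) * h' σ * f σ) x := by
    convert! HasDerivAt.fun_sum (u := Finset.univ) (fun σ _ => ((hh σ).exp.mul_const (f σ))) using 1
  have hz := (Z_pos (h x)).ne'
  have h3 := h2.div h1 hz
  convert! h3 using 1
  unfold gib
  have e : ∑ σ, Real.exp (h x σ) * h' σ * f σ = ∑ σ, Real.exp (h x σ) * (f σ * h' σ) :=
    Finset.sum_congr rfl fun σ _ => by ring
  rw [e]
  field_simp

lemma logZ_abs_le [Nonempty S] (h : S → ℝ) (C : ℝ) (hC : ∀ σ, |h σ| ≤ C) :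
    |Real.log (∑ σ, Real.exp (h σ))| ≤ C + Real.log (Fintype.card S) := by
  have hS : (1 : ℝ) ≤ Fintype.card S := by exact_mod_cast Fintype.card_pos (α := S)
  have hl := Real.log_nonneg hS
  rw [abs_le]
  constructor
  · obtain ⟨σ⟩ := ‹Nonempty S›
    have : Real.exp (h σ) ≤ ∑ σ, Real.exp (h σ) :=
      Finset.single_le_sum (f := fun σ => Real.exp (h σ)) (fun _ _ => (Real.exp_pos _).le)
        (Finset.mem_univ σ)
    have h2 := Real.log_le_log (Real.exp_pos _) this
    rw [Real.log_exp] at h2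
    have := (abs_le.1 (hC σ)).1
    linarith
  · have : ∑ σ, Real.exp (h σ) ≤ Real.exp C * Fintype.card S := by
      calc ∑ σ, Real.exp (h σ) ≤ ∑ σ : S, Real.exp C :=
            Finset.sum_le_sum fun σ _ => Real.exp_le_exp.2 (abs_le.1 (hC σ)).2
        _ = _ := by simp [mul_comm]
    have h2 := Real.log_le_log (Z_pos h) this
    rwa [Real.log_mul (Real.exp_pos _).ne' (by positivity), Real.log_exp] at h2

end gibbs

lemma integrable_abs_gauss : Integrable (fun x : ℝ => |x|) (gaussianReal 0 1) := by
  have : MemLp id 1 (gaussianReal 0 1) := memLp_id_gaussianReal 1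
  exact (memLp_one_iff_integrable.1 this).abs

/-- Stein identity in one dimension. -/
lemma stein_one (f f' : ℝ → ℝ) (C : ℝ) (hf : ∀ x, HasDerivAt f (f' x) x)
    (hb : ∀ x, |f x| ≤ C) (hb' : ∀ x, |f' x| ≤ C) :
    ∫ x, x * f x ∂(gaussianReal 0 1) = ∫ x, f' x ∂(gaussianReal 0 1) := by
  have hfc : Continuous f := continuous_iff_continuousAt.2 fun x => (hf x).continuousAt
  have hfm : Measurable f := hfc.measurable
  have hf'm : Measurable f' := by
    have : f' = deriv f := by ext x; exact (hf x).deriv.symm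
    rw [this]; exact measurable_deriv f
  rw [integral_gaussianReal_eq_integral_smul (by norm_num),
    integral_gaussianReal_eq_integral_smul (by norm_num)]
  simp only [smul_eq_mul]
  set v := gaussianPDFReal 0 1 with hvdef
  have hv : ∀ x, HasDerivAt v (-x * v x) x := by
    intro x
    have h1 : HasDerivAt (fun x : ℝ => -(x - 0) ^ 2 / (2 * ((1 : NNReal) : ℝ))) (-x) x := by
      have := (((hasDerivAt_id x).sub_const 0).pow 2).neg.div_const (2 * ((1 : NNReal) : ℝ))
      convert! this using 1
      simp
      ring
    have := (h1.exp).const_mul ((Real.sqrt (2 * Real.pi * ((1 : NNReal) : ℝ)))⁻¹)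
    convert! this using 1
    rw [hvdef, gaussianPDFReal]
    ring
  have hvi : Integrable v := integrable_gaussianPDFReal 0 1
  have hxv : Integrable (fun x => x * v x) := by
    have h := memLp_one_iff_integrable.1 (memLp_id_gaussianReal (μ := 0) (v := 1) 1)
    rw [gaussianReal_of_var_ne_zero _ (by norm_num)] at h
    rw [integrable_withDensity_iff_integrable_smul' (measurable_gaussianPDF 0 1)
      (ae_of_all _ fun x => gaussianPDF_lt_top)] at h
    refine h.congr (ae_of_all _ fun x => ?_)
    simp [hvdef, toReal_gaussianPDF, mul_comm]
  have key := integral_mul_deriv_eq_deriv_mul_of_integrable (u := f) (u' := f') (v := v)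
    (v' := fun x => -x * v x) (fun x _ => hf x) (fun x _ => hv x) ?_ ?_ ?_
  · have e1 : ∫ x, v x * (x * f x) = - ∫ x, f x * (-x * v x) := by
      rw [← integral_neg]; congr 1; ext x; ring
    rw [e1, key, neg_neg]; congr 1; ext x; ring
  · have : Integrable (fun x => f x * (x * v x)) :=
      hxv.bdd_mul hfm.aestronglyMeasurable (ae_of_all _ hb)
    refine this.neg.congr (ae_of_all _ fun x => ?_)
    simp
  · exact hvi.bdd_mul hf'm.aestronglyMeasurable (ae_of_all _ hb')
  · exact hvi.bdd_mul hfm.aestronglyMeasurable (ae_of_all _ hb)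

section pi
variable {ι : Type*} [Fintype ι] [DecidableEq ι]

lemma mp_update (p : ι) : MeasurePreserving (fun z : (ι → ℝ) × ℝ => Function.update z.1 p z.2)
    ((gpi ι).prod (gaussianReal 0 1)) (gpi ι) := by
  have hm : Measurable (fun z : (ι → ℝ) × ℝ => Function.update z.1 p z.2) := by
    refine measurable_pi_lambda _ fun i => ?_
    by_cases h : i = p
    · subst h; simpa using measurable_snd
    · simp only [Function.update_of_ne h]; fun_prop
  refine ⟨hm, ?_⟩
  symm
  refine Measure.pi_eq fun s hs => ?_
  rw [Measure.map_apply hm (MeasurableSet.univ_pi hs)]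
  have : (fun z : (ι → ℝ) × ℝ => Function.update z.1 p z.2) ⁻¹' (Set.univ.pi s)
      = (Set.univ.pi (Function.update s p Set.univ)) ×ˢ (s p) := by
    ext z
    simp only [Set.mem_preimage, Set.mem_pi, Set.mem_univ, true_imp_iff, Set.mem_prod]
    constructor
    · intro h
      refine ⟨fun i => ?_, by simpa using h p⟩
      by_cases hi : i = p
      · subst hi; simp
      · have := h i; simpa [Function.update_of_ne hi] using this
    · rintro ⟨h1, h2⟩ i
      by_cases hi : i = p
      · subst hi; simpa using h2
      · have := h1 i; simpa [Function.update_of_ne hi] using this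
  rw [this, Measure.prod_prod, Measure.pi_pi,
    ← Finset.mul_prod_erase Finset.univ _ (Finset.mem_univ p),
    ← Finset.mul_prod_erase Finset.univ (fun i => gaussianReal 0 1 (s i)) (Finset.mem_univ p)]
  simp only [Function.update_self, measure_univ, one_mul]
  rw [mul_comm]
  congr 1
  refine Finset.prod_congr rfl fun i hi => ?_
  rw [Function.update_of_ne (Finset.ne_of_mem_erase hi)]

lemma integrable_abs_eval (p : ι) : Integrable (fun g : ι → ℝ => |g p|) (gpi ι) :=
  integrable_comp_eval (μ := fun _ : ι => gaussianReal 0 1) (i := p) integrable_abs_gauss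

/-- Gaussian integration by parts on the product space. -/
lemma stein_pi (p : ι) (F F' : (ι → ℝ) → ℝ) (C : ℝ) (hFm : Measurable F) (hF'm : Measurable F')
    (hF : ∀ g x, HasDerivAt (fun y => F (Function.update g p y)) (F' (Function.update g p x)) x)
    (hb : ∀ g, |F g| ≤ C) (hb' : ∀ g, |F' g| ≤ C) :
    ∫ g, g p * F g ∂(gpi ι) = ∫ g, F' g ∂(gpi ι) := by
  have hi1 : Integrable (fun g : ι → ℝ => g p * F g) (gpi ι) := by
    have : Integrable (fun g : ι → ℝ => g p) (gpi ι) :=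
      (integrable_norm_iff (measurable_pi_apply p).aestronglyMeasurable).1 (integrable_abs_eval p)
    exact this.mul_bdd hFm.aestronglyMeasurable (ae_of_all _ hb)
  have hi2 : Integrable F' (gpi ι) :=
    Integrable.of_bound hF'm.aestronglyMeasurable C (ae_of_all _ hb')
  have e1 := (mp_update p).map_eq
  have j1 : Integrable (fun z : (ι → ℝ) × ℝ => Function.update z.1 p z.2 p *
      F (Function.update z.1 p z.2)) ((gpi ι).prod (gaussianReal 0 1)) :=
    (mp_update p).integrable_comp_of_integrable hi1
  have j2 : Integrable (fun z : (ι → ℝ) × ℝ =>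
      F' (Function.update z.1 p z.2)) ((gpi ι).prod (gaussianReal 0 1)) :=
    (mp_update p).integrable_comp_of_integrable hi2
  conv_lhs => rw [← e1]
  conv_rhs => rw [← e1]
  rw [integral_map (mp_update p).measurable.aemeasurable (by rw [e1]; exact hi1.1),
    integral_map (mp_update p).measurable.aemeasurable (by rw [e1]; exact hi2.1),
    integral_prod _ j1, integral_prod _ j2]
  congr 1; ext g
  simp only [Function.update_self]
  exact stein_one _ _ C (hF g) (fun _ => hb _) (fun _ => hb' _)
end pi

section interp
variable {ι S : Type*} [Fintype ι] [DecidableEq ι] [Fintype S]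

/-- Interpolating Hamiltonian. -/
noncomputable def Hin (u v : ι → S → ℝ) (B0 B1 : S → ℝ) (θ : ℝ) (g : ι → ℝ) (σ : S) : ℝ :=
  Real.sin θ * ∑ p, u p σ * g p + Real.cos θ * ∑ p, v p σ * g p
    + Real.sin θ ^ 2 * B0 σ + Real.cos θ ^ 2 * B1 σ

/-- The integrand of the derivative of the interpolating pressure. -/
noncomputable def Din (u v : ι → S → ℝ) (B0 B1 : S → ℝ) (θ : ℝ) (g : ι → ℝ) : ℝ :=
  ∑ p, ((gib (Hin u v B0 B1 θ g) (fun σ => u p σ * u p σ) - gib (Hin u v B0 B1 θ g) (u p) ^ 2)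
      - (gib (Hin u v B0 B1 θ g) (fun σ => v p σ * v p σ) - gib (Hin u v B0 B1 θ g) (v p) ^ 2))
    + 2 * (gib (Hin u v B0 B1 θ g) B0 - gib (Hin u v B0 B1 θ g) B1)

/-- The interpolating pressure. -/
noncomputable def Ain (u v : ι → S → ℝ) (B0 B1 : S → ℝ) (θ : ℝ) : ℝ :=
  ∫ g, Real.log (∑ σ, Real.exp (Hin u v B0 B1 θ g σ)) ∂(gpi ι)

variable (u v : ι → S → ℝ) (B0 B1 : S → ℝ)

lemma measurable_Hin (θ : ℝ) (σ : S) : Measurable (fun g => Hin u v B0 B1 θ g σ) := by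
  unfold Hin; fun_prop

lemma measurable_gib_Hin (θ : ℝ) (f : S → ℝ) :
    Measurable (fun g => gib (Hin u v B0 B1 θ g) f) := by
  have := measurable_Hin u v B0 B1 θ
  unfold gib; fun_prop

lemma exists_bound (f : S → ℝ) : ∃ K, 0 ≤ K ∧ ∀ σ, |f σ| ≤ K :=
  ⟨∑ σ, |f σ|, Finset.sum_nonneg fun _ _ => abs_nonneg _, fun σ =>
    Finset.single_le_sum (f := fun σ => |f σ|) (fun _ _ => abs_nonneg _) (Finset.mem_univ σ)⟩

lemma exists_bound2 (f : ι → S → ℝ) : ∃ K, 0 ≤ K ∧ ∀ p σ, |f p σ| ≤ K := by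
  obtain ⟨K, h0, h⟩ := exists_bound (fun z : ι × S => f z.1 z.2)
  exact ⟨K, h0, fun p σ => h (p, σ)⟩

lemma abs_lin_le (f : ι → S → ℝ) (K : ℝ) (h : ∀ p σ, |f p σ| ≤ K) (g : ι → ℝ) (σ : S) :
    |∑ p, f p σ * g p| ≤ K * ∑ p, |g p| := by
  rw [Finset.mul_sum]
  refine (Finset.abs_sum_le_sum_abs _ _).trans (Finset.sum_le_sum fun p _ => ?_)
  rw [abs_mul]
  exact mul_le_mul_of_nonneg_right (h p σ) (abs_nonneg _)

lemma exists_common : ∃ K, 0 ≤ K ∧ (∀ p σ, |u p σ| ≤ K) ∧ (∀ p σ, |v p σ| ≤ K) ∧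
    (∀ σ, |B0 σ| ≤ K) ∧ (∀ σ, |B1 σ| ≤ K) := by
  obtain ⟨K1, h10, h1⟩ := exists_bound2 u
  obtain ⟨K2, h20, h2⟩ := exists_bound2 v
  obtain ⟨K3, h30, h3⟩ := exists_bound B0
  obtain ⟨K4, h40, h4⟩ := exists_bound B1
  refine ⟨K1 + K2 + K3 + K4, by positivity, fun p σ => ?_, fun p σ => ?_, fun σ => ?_,
    fun σ => ?_⟩
  · linarith [h1 p σ]
  · linarith [h2 p σ]
  · linarith [h3 σ]
  · linarith [h4 σ]

lemma integrable_sum_abs : Integrable (fun g : ι → ℝ => ∑ p, |g p|) (gpi ι) := by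
  classical
  exact integrable_finsetSum _ fun p _ => integrable_abs_eval p

lemma abs_mul_le_of_le_one {a b c : ℝ} (ha : |a| ≤ 1) (hb : |b| ≤ c) : |a * b| ≤ c := by
  rw [abs_mul]
  calc |a| * |b| ≤ 1 * |b| := mul_le_mul_of_nonneg_right ha (abs_nonneg _)
    _ ≤ c := by linarith

lemma Hin_abs_le : ∃ K, ∀ θ g σ, |Hin u v B0 B1 θ g σ| ≤ K * ∑ p, |g p| + K := by
  obtain ⟨K, hK, h1, h2, h3, h4⟩ := exists_common u v B0 B1
  refine ⟨2 * K, fun θ g σ => ?_⟩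
  unfold Hin
  have a1 := abs_mul_le_of_le_one (Real.abs_sin_le_one θ) (abs_lin_le u K h1 g σ)
  have a2 := abs_mul_le_of_le_one (Real.abs_cos_le_one θ) (abs_lin_le v K h2 g σ)
  have a3 : |Real.sin θ ^ 2 * B0 σ| ≤ K := abs_mul_le_of_le_one
    (by rw [abs_pow]; exact pow_le_one₀ (abs_nonneg _) (Real.abs_sin_le_one θ)) (h3 σ)
  have a4 : |Real.cos θ ^ 2 * B1 σ| ≤ K := abs_mul_le_of_le_one
    (by rw [abs_pow]; exact pow_le_one₀ (abs_nonneg _) (Real.abs_cos_le_one θ)) (h4 σ)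
  refine (abs_add_le _ _).trans ?_
  refine (add_le_add_left ((abs_add_le _ _).trans
    (add_le_add_left (abs_add_le _ _) _)) _).trans ?_
  linarith

lemma integrable_logZ [Nonempty S] (θ : ℝ) :
    Integrable (fun g => Real.log (∑ σ, Real.exp (Hin u v B0 B1 θ g σ))) (gpi ι) := by
  obtain ⟨K, hK⟩ := Hin_abs_le u v B0 B1
  have hb : Integrable (fun g : ι → ℝ => K * ∑ p, |g p| + K + Real.log (Fintype.card S)) (gpi ι) :=
    ((integrable_sum_abs.const_mul K).add (integrable_const _)).add (integrable_const _)
  refine hb.mono' ?_ (ae_of_all _ fun g => logZ_abs_le _ _ (hK θ g))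
  have := measurable_Hin u v B0 B1 θ
  exact (by fun_prop : Measurable _).aestronglyMeasurable

/-- Derivative of the interpolating pressure. -/
theorem hasDerivAt_Ain [Nonempty S] (huv : ∀ p, (∀ σ, u p σ = 0) ∨ (∀ σ, v p σ = 0)) (θ : ℝ) :
    HasDerivAt (Ain u v B0 B1)
      (Real.sin θ * Real.cos θ * ∫ g, Din u v B0 B1 θ g ∂(gpi ι)) θ := by
  obtain ⟨K, hK, h1, h2, h3, h4⟩ := exists_common u v B0 B1
  -- the theta derivative of the Hamiltonian
  set H' : ℝ → (ι → ℝ) → S → ℝ := fun θ g σ =>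
    ∑ p, g p * (Real.cos θ * u p σ - Real.sin θ * v p σ)
      + 2 * Real.sin θ * Real.cos θ * (B0 σ - B1 σ) with hH'
  have hd : ∀ θ g σ, HasDerivAt (fun t => Hin u v B0 B1 t g σ) (H' θ g σ) θ := by
    intro θ g σ
    have s1 := (Real.hasDerivAt_sin θ).mul_const (∑ p, u p σ * g p)
    have s2 := (Real.hasDerivAt_cos θ).mul_const (∑ p, v p σ * g p)
    have s3 := ((Real.hasDerivAt_sin θ).fun_pow 2).mul_const (B0 σ)
    have s4 := ((Real.hasDerivAt_cos θ).fun_pow 2).mul_const (B1 σ)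
    convert! ((s1.fun_add s2).fun_add s3).fun_add s4 using 1
    simp only [hH', mul_sub, Finset.sum_sub_distrib]
    have e1 : ∑ p, g p * (Real.cos θ * u p σ) = Real.cos θ * ∑ p, u p σ * g p := by
      rw [Finset.mul_sum]; exact Finset.sum_congr rfl fun p _ => by ring
    have e2 : ∑ p, g p * (Real.sin θ * v p σ) = Real.sin θ * ∑ p, v p σ * g p := by
      rw [Finset.mul_sum]; exact Finset.sum_congr rfl fun p _ => by ring
    rw [e1, e2]; simp; ring
  have kb : ∀ θ p σ, |Real.cos θ * u p σ - Real.sin θ * v p σ| ≤ 2 * K := by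
    intro θ p σ
    have a1 := abs_mul_le_of_le_one (Real.abs_cos_le_one θ) (h1 p σ)
    have a2 := abs_mul_le_of_le_one (Real.abs_sin_le_one θ) (h2 p σ)
    exact (abs_sub _ _).trans (by linarith)
  have kb2 : ∀ θ p σ, |Real.sin θ * u p σ + Real.cos θ * v p σ| ≤ 2 * K := by
    intro θ p σ
    have a1 := abs_mul_le_of_le_one (Real.abs_sin_le_one θ) (h1 p σ)
    have a2 := abs_mul_le_of_le_one (Real.abs_cos_le_one θ) (h2 p σ)
    exact (abs_add_le _ _).trans (by linarith)
  have hH'b : ∀ θ g σ, |H' θ g σ| ≤ 2 * K * ∑ p, |g p| + 4 * K := by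
    intro θ g σ
    have a1 : |∑ p, g p * (Real.cos θ * u p σ - Real.sin θ * v p σ)| ≤ 2 * K * ∑ p, |g p| := by
      have := abs_lin_le (fun p σ => Real.cos θ * u p σ - Real.sin θ * v p σ) (2 * K) (kb θ) g σ
      simpa only [mul_comm (g _)] using this
    have a2 : |2 * Real.sin θ * Real.cos θ * (B0 σ - B1 σ)| ≤ 4 * K := by
      have : |B0 σ - B1 σ| ≤ 2 * K := (abs_sub _ _).trans (by linarith [h3 σ, h4 σ])
      have c := abs_mul_le_of_le_one (Real.abs_sin_le_one θ)
        (abs_mul_le_of_le_one (Real.abs_cos_le_one θ) this)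
      have e : 2 * Real.sin θ * Real.cos θ * (B0 σ - B1 σ)
        = 2 * (Real.sin θ * (Real.cos θ * (B0 σ - B1 σ))) := by ring
      rw [e, abs_mul, abs_two]; linarith
    exact (abs_add_le _ _).trans (add_le_add a1 a2)
  have hbi : Integrable (fun g : ι → ℝ => 2 * K * ∑ p, |g p| + 4 * K) (gpi ι) :=
    (integrable_sum_abs.const_mul _).add (integrable_const _)
  have main := hasDerivAt_integral_of_dominated_loc_of_deriv_le (μ := gpi ι) (𝕜 := ℝ)
    (F := fun t g => Real.log (∑ σ, Real.exp (Hin u v B0 B1 t g σ)))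
    (F' := fun t g => gib (Hin u v B0 B1 t g) (H' t g)) (x₀ := θ) (s := Set.univ)
    (bound := fun g => 2 * K * ∑ p, |g p| + 4 * K)
    Filter.univ_mem (Eventually.of_forall fun t => (integrable_logZ u v B0 B1 t).1)
    (integrable_logZ u v B0 B1 θ)
    (by
      have := measurable_Hin u v B0 B1 θ
      refine Measurable.aestronglyMeasurable ?_
      simp only [gib, hH']
      fun_prop)
    (ae_of_all _ fun g t _ => gib_abs_le _ _ _ (hH'b t g))
    hbi (ae_of_all _ fun g t _ => hasDerivAt_logZ (fun σ => hd t g σ))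
  refine main.2.congr_deriv ?_
  -- expand and integrate by parts
  have ex : ∀ g, gib (Hin u v B0 B1 θ g) (H' θ g) =
      ∑ p, g p * gib (Hin u v B0 B1 θ g) (fun σ => Real.cos θ * u p σ - Real.sin θ * v p σ)
      + 2 * Real.sin θ * Real.cos θ *
        (gib (Hin u v B0 B1 θ g) B0 - gib (Hin u v B0 B1 θ g) B1) := by
    intro g
    simp only [hH']
    rw [gib_add, gib_sum, gib_mul, gib_sub]
    simp only [gib_mul]
  have mg := measurable_gib_Hin u v B0 B1 θ
  have ibp : ∀ p, ∫ g, g p * gib (Hin u v B0 B1 θ g)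
        (fun σ => Real.cos θ * u p σ - Real.sin θ * v p σ) ∂(gpi ι)
      = ∫ g, Real.sin θ * Real.cos θ *
       ((gib (Hin u v B0 B1 θ g) (fun σ => u p σ * u p σ) - gib (Hin u v B0 B1 θ g) (u p) ^ 2)
      - (gib (Hin u v B0 B1 θ g) (fun σ => v p σ * v p σ) - gib (Hin u v B0 B1 θ g) (v p) ^ 2))
        ∂(gpi ι) := by
    intro p
    set k' : S → ℝ := fun σ => Real.cos θ * u p σ - Real.sin θ * v p σ with hk'
    set k : S → ℝ := fun σ => Real.sin θ * u p σ + Real.cos θ * v p σ with hk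
    have st := stein_pi p (fun g => gib (Hin u v B0 B1 θ g) k')
      (fun g => gib (Hin u v B0 B1 θ g) (fun σ => k' σ * k σ)
        - gib (Hin u v B0 B1 θ g) k' * gib (Hin u v B0 B1 θ g) k)
      (2 * K + 8 * K ^ 2) (mg _) ((mg _).sub ((mg _).mul (mg _))) ?_ ?_ ?_
    · rw [st]
      refine integral_congr_ae (ae_of_all _ fun g => ?_)
      simp only [hk, hk']
      rcases huv p with h | h
      · have hu : u p = fun _ => 0 := funext h
        simp only [hu, mul_zero, zero_sub, zero_add, gib_const]
        have e1 : (fun σ => -(Real.sin θ * v p σ) * (Real.cos θ * v p σ)) =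
          fun σ => (-(Real.sin θ * Real.cos θ)) * (v p σ * v p σ) := by ext; ring
        have e2 : (fun σ => -(Real.sin θ * v p σ)) = fun σ => (-Real.sin θ) * v p σ := by
          ext; ring
        rw [e1, e2, gib_mul, gib_mul, gib_mul]; ring
      · have hv : v p = fun _ => 0 := funext h
        simp only [hv, mul_zero, sub_zero, add_zero, gib_const]
        have e1 : (fun σ => (Real.cos θ * u p σ) * (Real.sin θ * u p σ)) =
          fun σ => (Real.sin θ * Real.cos θ) * (u p σ * u p σ) := by ext; ring
        rw [e1, gib_mul, gib_mul, gib_mul]; ring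
    · intro g x
      refine hasDerivAt_gib (h := fun y => Hin u v B0 B1 θ (Function.update g p y)) k' fun σ => ?_
      have lin : ∀ f : ι → S → ℝ, HasDerivAt
          (fun y => ∑ i, f i σ * Function.update g p y i) (f p σ) x := by
        intro f
        have : (fun y => ∑ i, f i σ * Function.update g p y i) =
            fun y => f p σ * y + ∑ i ∈ Finset.univ.erase p, f i σ * g i := by
          ext y
          rw [← Finset.add_sum_erase Finset.univ _ (Finset.mem_univ p)]
          simp only [Function.update_self]
          congr 1
          refine Finset.sum_congr rfl fun i hi => ?_
          rw [Function.update_of_ne (Finset.ne_of_mem_erase hi)]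
        rw [this]
        simpa using ((hasDerivAt_id x).const_mul (f p σ)).add_const
          (∑ i ∈ Finset.univ.erase p, f i σ * g i)
      have := ((((lin u).const_mul (Real.sin θ)).fun_add ((lin v).const_mul (Real.cos θ))).add_const
        (Real.sin θ ^ 2 * B0 σ)).add_const (Real.cos θ ^ 2 * B1 σ)
      exact this
    · intro g
      exact (gib_abs_le _ _ _ (kb θ p)).trans (by nlinarith)
    · intro g
      have b1 : |gib (Hin u v B0 B1 θ g) (fun σ => k' σ * k σ)| ≤ 2 * K * (2 * K) :=
        gib_abs_le _ _ _ fun σ => by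
          rw [abs_mul]; exact mul_le_mul (kb θ p σ) (kb2 θ p σ) (abs_nonneg _) (by positivity)
      have b2 : |gib (Hin u v B0 B1 θ g) k' * gib (Hin u v B0 B1 θ g) k| ≤ 2 * K * (2 * K) := by
        rw [abs_mul]
        exact mul_le_mul (gib_abs_le _ _ _ (kb θ p)) (gib_abs_le _ _ _ (kb2 θ p))
          (abs_nonneg _) (by positivity)
      exact (abs_sub _ _).trans (by nlinarith)
  have bddint : ∀ f : S → ℝ, Integrable (fun g => gib (Hin u v B0 B1 θ g) f) (gpi ι) := by
    intro f
    obtain ⟨C, _, hC⟩ := exists_bound f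
    exact Integrable.of_bound (mg f).aestronglyMeasurable C (ae_of_all _ fun g => gib_abs_le _ _ _ hC)
  have bddint2 : ∀ f : S → ℝ, Integrable (fun g => gib (Hin u v B0 B1 θ g) f ^ 2) (gpi ι) := by
    intro f
    obtain ⟨C, _, hC⟩ := exists_bound f
    refine Integrable.of_bound ((mg f).pow_const 2).aestronglyMeasurable (C ^ 2)
      (ae_of_all _ fun g => ?_)
    rw [norm_pow]
    exact pow_le_pow_left₀ (norm_nonneg _) (gib_abs_le _ _ _ hC) 2
  have i1 : ∀ p, Integrable (fun g => g p * gib (Hin u v B0 B1 θ g)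
        (fun σ => Real.cos θ * u p σ - Real.sin θ * v p σ)) (gpi ι) := by
    intro p
    have : Integrable (fun g : ι → ℝ => g p) (gpi ι) :=
      (integrable_norm_iff (measurable_pi_apply p).aestronglyMeasurable).1 (integrable_abs_eval p)
    exact this.mul_bdd (mg _).aestronglyMeasurable
      (ae_of_all _ fun g => gib_abs_le _ _ _ (kb θ p))
  have i2 : Integrable (fun g => 2 * Real.sin θ * Real.cos θ *
        (gib (Hin u v B0 B1 θ g) B0 - gib (Hin u v B0 B1 θ g) B1)) (gpi ι) :=
    ((bddint B0).sub (bddint B1)).const_mul _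
  simp only [ex]
  rw [integral_add (integrable_finsetSum _ fun p _ => i1 p) i2, integral_finsetSum _ fun p _ => i1 p]
  simp only [ibp]
  rw [← integral_finsetSum, ← integral_add, ← integral_const_mul]
  · congr 1; ext g
    rw [Din, ← Finset.mul_sum]; ring
  · exact integrable_finsetSum _ fun p _ =>
      (((bddint _).sub (bddint2 _)).sub ((bddint _).sub (bddint2 _))).const_mul _
  · exact i2
  · exact fun p _ =>
      (((bddint _).sub (bddint2 _)).sub ((bddint _).sub (bddint2 _))).const_mul _

theorem Ain_mono [Nonempty S] (huv : ∀ p, (∀ σ, u p σ = 0) ∨ (∀ σ, v p σ = 0))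
    (hD : ∀ θ, 0 ≤ ∫ g, Din u v B0 B1 θ g ∂(gpi ι)) :
    Ain u v B0 B1 0 ≤ Ain u v B0 B1 (Real.pi / 2) := by
  have hd := hasDerivAt_Ain u v B0 B1 huv
  have : MonotoneOn (Ain u v B0 B1) (Set.Icc 0 (Real.pi / 2)) := by
    refine monotoneOn_of_deriv_nonneg (convex_Icc _ _)
      (fun x _ => (hd x).continuousAt.continuousWithinAt)
      (fun x _ => (hd x).differentiableAt.differentiableWithinAt) fun x hx => ?_
    rw [interior_Icc] at hx
    rw [(hd x).deriv]
    have := Real.sin_nonneg_of_nonneg_of_le_pi hx.1.le (by linarith [hx.2, Real.pi_pos])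
    have := Real.cos_nonneg_of_neg_pi_div_two_le_of_le (by linarith [hx.1, Real.pi_pos]) hx.2.le
    have := hD x
    positivity
  have hp := Real.pi_pos
  exact this ⟨le_rfl, by linarith⟩ ⟨by linarith, le_rfl⟩ (by linarith)

theorem Ain_anti [Nonempty S] (huv : ∀ p, (∀ σ, u p σ = 0) ∨ (∀ σ, v p σ = 0))
    (hD : ∀ θ, ∫ g, Din u v B0 B1 θ g ∂(gpi ι) ≤ 0) :
    Ain u v B0 B1 (Real.pi / 2) ≤ Ain u v B0 B1 0 := by
  have hd := hasDerivAt_Ain u v B0 B1 huv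
  have : AntitoneOn (Ain u v B0 B1) (Set.Icc 0 (Real.pi / 2)) := by
    refine antitoneOn_of_deriv_nonpos (convex_Icc _ _)
      (fun x _ => (hd x).continuousAt.continuousWithinAt)
      (fun x _ => (hd x).differentiableAt.differentiableWithinAt) fun x hx => ?_
    rw [interior_Icc] at hx
    rw [(hd x).deriv]
    have := Real.sin_nonneg_of_nonneg_of_le_pi hx.1.le (by linarith [hx.2, Real.pi_pos])
    have := Real.cos_nonneg_of_neg_pi_div_two_le_of_le (by linarith [hx.1, Real.pi_pos]) hx.2.le
    exact mul_nonpos_of_nonneg_of_nonpos (by positivity) (hD x)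
  have hp := Real.pi_pos
  exact this ⟨le_rfl, by linarith⟩ ⟨by linarith, le_rfl⟩ (by linarith)
end interp

lemma gauss_shift_density (a : ℝ) : gaussianReal a 1 =
    (gaussianReal 0 1).withDensity (fun x => ENNReal.ofReal (Real.exp (a * x - a ^ 2 / 2))) := by
  rw [gaussianReal_of_var_ne_zero _ one_ne_zero, gaussianReal_of_var_ne_zero _ one_ne_zero,
    ← withDensity_mul _ (measurable_gaussianPDF 0 1) (by fun_prop)]
  congr 1; ext x
  simp only [Pi.mul_apply, gaussianPDF, gaussianPDFReal]
  rw [← ENNReal.ofReal_mul (by positivity)]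
  congr 1
  rw [mul_assoc (_⁻¹), ← Real.exp_add]
  congr 2
  simp; ring

section nish
variable {ι : Type*} [Fintype ι]

lemma integrable_exp_one (a : ℝ) :
    Integrable (fun x : ℝ => Real.exp (a * x - a ^ 2 / 2)) (gaussianReal 0 1) := by
  have := (integrable_exp_mul_gaussianReal (μ := 0) (v := 1) a).mul_const (Real.exp (- (a ^ 2 / 2)))
  refine this.congr (ae_of_all _ fun x => ?_)
  simp only [← Real.exp_add]; congr 1

lemma pi_shift_density (a : ι → ℝ) : Measure.pi (fun p => gaussianReal (a p) 1) =
    (gpi ι).withDensity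
      (fun g => ENNReal.ofReal (∏ p, Real.exp (a p * g p - a p ^ 2 / 2))) := by
  refine Measure.pi_eq fun s hs => ?_
  rw [withDensity_apply _ (MeasurableSet.univ_pi hs), ← lintegral_indicator (MeasurableSet.univ_pi hs)]
  have e : ∀ g : ι → ℝ, (Set.univ.pi s).indicator
      (fun g => ENNReal.ofReal (∏ p, Real.exp (a p * g p - a p ^ 2 / 2))) g =
      ENNReal.ofReal (∏ p, (s p).indicator (fun x => Real.exp (a p * x - a p ^ 2 / 2)) (g p)) := by
    intro g
    by_cases hg : g ∈ Set.univ.pi s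
    · rw [Set.indicator_of_mem hg]
      congr 1
      refine Finset.prod_congr rfl fun p _ => ?_
      rw [Set.indicator_of_mem (hg p trivial)]
    · rw [Set.indicator_of_notMem hg]
      simp only [Set.mem_pi, not_forall] at hg
      obtain ⟨p, _, hp⟩ := hg
      rw [Finset.prod_eq_zero (Finset.mem_univ p) (Set.indicator_of_notMem hp _), ENNReal.ofReal_zero]
  simp only [e]
  have hi : ∀ p, Integrable ((s p).indicator (fun x => Real.exp (a p * x - a p ^ 2 / 2)))
    (gaussianReal 0 1) := fun p => (integrable_exp_one (a p)).indicator (hs p)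
  have hnn : ∀ p x, 0 ≤ (s p).indicator (fun x => Real.exp (a p * x - a p ^ 2 / 2)) x :=
    fun p x => Set.indicator_nonneg (fun _ _ => (Real.exp_pos _).le) x
  rw [← ofReal_integral_eq_lintegral_ofReal (Integrable.fintype_prod hi)
    (ae_of_all _ fun g => Finset.prod_nonneg fun p _ => hnn p (g p)),
    integral_fintype_prod_eq_prod, ENNReal.ofReal_prod_of_nonneg
      (fun p _ => integral_nonneg (hnn p))]
  refine Finset.prod_congr rfl fun p _ => ?_
  rw [ofReal_integral_eq_lintegral_ofReal (hi p) (ae_of_all _ (hnn p)), gauss_shift_density (a p),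
    withDensity_apply _ (hs p), ← lintegral_indicator (hs p)]
  congr 1; ext x
  by_cases hx : x ∈ s p <;> simp [hx]

lemma mp_shift (a : ι → ℝ) : MeasurePreserving (fun g : ι → ℝ => fun p => g p + a p) (gpi ι)
    (Measure.pi fun p => gaussianReal (a p) 1) := by
  refine measurePreserving_pi (fun _ => gaussianReal 0 1) (fun p => gaussianReal (a p) 1)
    (f := fun p x => x + a p) fun p => ⟨by fun_prop, ?_⟩
  rw [gaussianReal_map_add_const]; simp

lemma mp_sign (s : ι → ℝ) (hs : ∀ p, s p * s p = 1) :
    MeasurePreserving (fun g : ι → ℝ => fun p => s p * g p) (gpi ι) (gpi ι) := by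
  refine measurePreserving_pi (fun _ => gaussianReal 0 1) (fun _ => gaussianReal 0 1)
    (f := fun p x => s p * x) fun p => ⟨by fun_prop, ?_⟩
  rw [gaussianReal_map_const_mul]
  congr 1
  · simp
  · ext; simp [sq, hs p]

/-- Cameron–Martin formula. -/
lemma cameron_martin (a : ι → ℝ) (F : (ι → ℝ) → ℝ) (hF : Measurable F) :
    ∫ g, F (fun p => g p + a p) ∂(gpi ι) =
      ∫ g, (∏ p, Real.exp (a p * g p - a p ^ 2 / 2)) * F g ∂(gpi ι) := by
  have h1 := (mp_shift a).map_eq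
  rw [← integral_map (φ := fun g : ι → ℝ => fun p => g p + a p) (f := F)
    (mp_shift a).measurable.aemeasurable hF.aestronglyMeasurable, h1, pi_shift_density,
    integral_withDensity_eq_integral_toReal_smul (by fun_prop) (ae_of_all _ fun _ => by simp)]
  congr 1; ext g
  rw [ENNReal.toReal_ofReal (Finset.prod_nonneg fun p _ => (Real.exp_pos _).le), smul_eq_mul]

variable {S : Type*} [Fintype S]

/-- The Nishimori identity. -/
theorem nishimori [Nonempty S] (χ : ι → S → ℝ) (op : S → S → S) (hop : ∀ τ, Function.Bijective (op τ))
    (hmul : ∀ p τ σ, χ p (op τ σ) = χ p τ * χ p σ) (hsq : ∀ p σ, χ p σ * χ p σ = 1)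
    (α : ι → ℝ) (p : ι) :
    ∫ g, gib (fun σ => ∑ i, α i * χ i σ * (g i + α i)) (χ p) ∂(gpi ι) =
      ∫ g, gib (fun σ => ∑ i, α i * χ i σ * (g i + α i)) (χ p) ^ 2 ∂(gpi ι) := by
  set F : (ι → ℝ) → ℝ := fun h => gib (fun σ => ∑ i, α i * χ i σ * h i) (χ p) with hFdef
  have hFm : Measurable F := by simp only [hFdef, gib]; fun_prop
  have hF1 : ∀ h, |F h| ≤ 1 := fun h => gib_abs_le _ _ _ fun σ => by
    have := hsq p σ
    rw [abs_le]; constructor <;> nlinarith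
  have gauge : ∀ τ h, F (fun i => χ i τ * h i) = χ p τ * F h := by
    intro τ h
    simp only [hFdef, gib]
    have e1 : ∀ f : S → ℝ, ∑ σ, f σ = ∑ σ, f (op τ σ) := fun f =>
      (Function.Bijective.sum_comp (hop τ) f).symm
    have e2 : ∀ σ, ∑ i, α i * χ i (op τ σ) * (χ i τ * h i) = ∑ i, α i * χ i σ * h i := by
      intro σ
      refine Finset.sum_congr rfl fun i _ => ?_
      rw [hmul]
      linear_combination (α i * χ i σ * h i) * hsq i τ
    rw [e1, e1 (fun σ => Real.exp (∑ i, α i * χ i σ * (χ i τ * h i)))]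
    simp only [e2]
    simp only [hmul]
    rw [← mul_div_assoc, Finset.mul_sum]
    congr 1
    exact Finset.sum_congr rfl fun σ _ => by ring
  have step : ∀ (G : (ι → ℝ) → ℝ), Measurable G → ∀ τ,
      ∫ g, G (fun i => g i + α i) ∂(gpi ι) =
      ∫ g, (∏ i, Real.exp ((χ i τ * α i) * g i - (χ i τ * α i) ^ 2 / 2)) *
        G (fun i => χ i τ * g i) ∂(gpi ι) := by
    intro G hG τ
    have hs : ∀ i, χ i τ * χ i τ = 1 := fun i => hsq i τ
    have hmp := mp_sign (fun i => χ i τ) hs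
    rw [← cameron_martin (fun i => χ i τ * α i) (fun g => G (fun i => χ i τ * g i)) (by fun_prop)]
    conv_lhs => rw [← hmp.map_eq]
    rw [integral_map hmp.measurable.aemeasurable
      (by exact (by fun_prop : Measurable _).aestronglyMeasurable)]
    congr 1; ext g; congr 1; ext i
    linear_combination (-α i) * hs i
  set c : ℝ := Real.exp (-∑ i, α i ^ 2 / 2)
  have dens : ∀ (τ : S) (g : ι → ℝ), ∏ i, Real.exp ((χ i τ * α i) * g i - (χ i τ * α i) ^ 2 / 2)
      = c * Real.exp (∑ i, α i * χ i τ * g i) := by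
    intro τ g
    rw [← Real.exp_sum, ← Real.exp_add, ← Finset.sum_neg_distrib, ← Finset.sum_add_distrib]
    congr 1
    refine Finset.sum_congr rfl fun i _ => ?_
    linear_combination (-(α i ^ 2) / 2) * hsq i τ
  have hIntG : ∀ τ (G : (ι → ℝ) → ℝ), Measurable G → (∀ g, |G g| ≤ 1) →
      Integrable (fun g => (∏ i, Real.exp ((χ i τ * α i) * g i - (χ i τ * α i) ^ 2 / 2)) * G g)
        (gpi ι) := by
    intro τ G hG hb
    exact (Integrable.fintype_prod (f := fun i x => Real.exp ((χ i τ * α i) * x - (χ i τ * α i) ^ 2 / 2))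
      (fun i => integrable_exp_one _)).mul_bdd hG.aestronglyMeasurable (ae_of_all _ hb)
  have A : ∀ τ, ∫ g, F (fun i => g i + α i) ∂(gpi ι) =
      ∫ g, (∏ i, Real.exp ((χ i τ * α i) * g i - (χ i τ * α i) ^ 2 / 2)) *
        (χ p τ * F g) ∂(gpi ι) := by
    intro τ; rw [step F hFm τ]; simp only [gauge]
  have B : ∀ τ, ∫ g, F (fun i => g i + α i) ^ 2 ∂(gpi ι) =
      ∫ g, (∏ i, Real.exp ((χ i τ * α i) * g i - (χ i τ * α i) ^ 2 / 2)) *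
        (F g ^ 2) ∂(gpi ι) := by
    intro τ; rw [step (fun g => F g ^ 2) (by fun_prop) τ]; simp only [gauge, mul_pow]
    have : χ p τ ^ 2 = 1 := by rw [sq]; exact hsq p τ
    simp only [this, one_mul]
  have chi1 : ∀ τ, |χ p τ| ≤ 1 := fun τ => by
    have := hsq p τ
    rw [abs_le]; constructor <;> nlinarith
  have cS : (Fintype.card S : ℝ) ≠ 0 := by exact_mod_cast Fintype.card_ne_zero
  refine mul_left_cancel₀ cS ?_
  have sA : (Fintype.card S : ℝ) * ∫ g, F (fun i => g i + α i) ∂(gpi ι) =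
      ∑ τ : S, ∫ g, (∏ i, Real.exp ((χ i τ * α i) * g i - (χ i τ * α i) ^ 2 / 2)) *
        (χ p τ * F g) ∂(gpi ι) := by
    simp only [← A]; simp
  have sB : (Fintype.card S : ℝ) * ∫ g, F (fun i => g i + α i) ^ 2 ∂(gpi ι) =
      ∑ τ : S, ∫ g, (∏ i, Real.exp ((χ i τ * α i) * g i - (χ i τ * α i) ^ 2 / 2)) *
        (F g ^ 2) ∂(gpi ι) := by
    simp only [← B]; simp
  change (Fintype.card S : ℝ) * ∫ g, F (fun i => g i + α i) ∂(gpi ι) =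
    (Fintype.card S : ℝ) * ∫ g, F (fun i => g i + α i) ^ 2 ∂(gpi ι)
  rw [sA, sB, ← integral_finsetSum, ← integral_finsetSum]
  · congr 1; ext g
    simp only [dens]
    rw [← Finset.sum_mul]
    have hz := (Z_pos (fun σ => ∑ i, α i * χ i σ * g i)).ne'
    have : F g * ∑ σ, Real.exp (∑ i, α i * χ i σ * g i)
        = ∑ σ, Real.exp (∑ i, α i * χ i σ * g i) * χ p σ := by
      simp only [hFdef, gib]; field_simp
    rw [← Finset.mul_sum, sq]
    calc _ = c * F g * ∑ σ, Real.exp (∑ i, α i * χ i σ * g i) * χ p σ := by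
          rw [Finset.mul_sum]; exact Finset.sum_congr rfl fun σ _ => by ring
      _ = _ := by rw [← this]; ring
  · intro τ _
    exact hIntG τ _ (by fun_prop) fun g => by
      rw [abs_pow]; exact pow_le_one₀ (abs_nonneg _) (hF1 g)
  · intro τ _
    exact hIntG τ _ (by fun_prop) fun g => abs_mul_le_of_le_one (chi1 τ) (hF1 g)
end nish

section sk

lemma spin_sq {N : ℕ} (σ : Fin N → Bool) (i : Fin N) : spin σ i * spin σ i = 1 := by
  unfold spin; split_ifs <;> norm_num

/-- The SK pressure (not normalised) on the Nishimori line. -/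
noncomputable def skTarget (β : ℝ) (N : ℕ) : ℝ :=
  ∫ J : Fin N × Fin N → ℝ,
    Real.log (∑ σ : Fin N → Bool, Real.exp
      (∑ p ∈ Finset.univ.filter (fun p : Fin N × Fin N => p.1 ≠ p.2),
        (β / Real.sqrt (2 * (N : ℝ))) * J p * spin σ p.1 * spin σ p.2))
    ∂(Measure.pi fun _ : Fin N × Fin N => gaussianReal (β / Real.sqrt (2 * (N : ℝ))) 1)

/-- magnetisation -/
noncomputable def mag {N : ℕ} (σ : Fin N → Bool) : ℝ := (∑ i, spin σ i) / N

/-- pair couplings -/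
noncomputable def skU (β : ℝ) (N : ℕ) : (Fin N × Fin N) ⊕ Fin N → (Fin N → Bool) → ℝ :=
  Sum.elim (fun p σ => if p.1 ≠ p.2 then
    β / Real.sqrt (2 * (N : ℝ)) * (spin σ p.1 * spin σ p.2) else 0) (fun _ _ => 0)

/-- site couplings -/
noncomputable def skV (β : ℝ) (N : ℕ) (s : (Fin N → Bool) → ℝ) :
    (Fin N × Fin N) ⊕ Fin N → (Fin N → Bool) → ℝ :=
  Sum.elim (fun _ _ => 0) (fun i σ => β * (s σ * spin σ i))

/-- drift of the pair couplings -/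
noncomputable def skB0 (β : ℝ) (N : ℕ) (σ : Fin N → Bool) : ℝ :=
  ∑ p : Fin N × Fin N, if p.1 ≠ p.2 then
    (β / Real.sqrt (2 * (N : ℝ))) ^ 2 * (spin σ p.1 * spin σ p.2) else 0

lemma a0_sq (β : ℝ) (N : ℕ) : (β / Real.sqrt (2 * (N : ℝ))) ^ 2 = β ^ 2 / (2 * N) := by
  rw [div_pow, Real.sq_sqrt (by positivity)]

lemma sum_ss {N : ℕ} (σ : Fin N → Bool) :
    ∑ p : Fin N × Fin N, spin σ p.1 * spin σ p.2 = (∑ i, spin σ i) ^ 2 := by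
  rw [sq, Finset.sum_mul_sum, Fintype.sum_prod_type]

lemma sum_spin {N : ℕ} (hN : 0 < N) (σ : Fin N → Bool) : ∑ i, spin σ i = N * mag σ := by
  have : (N : ℝ) ≠ 0 := by positivity
  unfold mag; field_simp

lemma sum_ss_off {N : ℕ} (σ : Fin N → Bool) :
    (∑ p : Fin N × Fin N, if p.1 ≠ p.2 then spin σ p.1 * spin σ p.2 else 0)
      = (∑ i, spin σ i) ^ 2 - N := by
  rw [← sum_ss]
  have : ∀ p : Fin N × Fin N, (if p.1 ≠ p.2 then spin σ p.1 * spin σ p.2 else 0)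
      = spin σ p.1 * spin σ p.2 - if p.1 = p.2 then 1 else 0 := by
    intro p
    by_cases h : p.1 = p.2
    · simp [h, spin_sq]
    · simp [h]
  simp only [this, Finset.sum_sub_distrib]
  congr 1
  rw [Fintype.sum_prod_type]; simp

lemma skB0_eq (β : ℝ) {N : ℕ} (hN : 0 < N) (σ : Fin N → Bool) :
    skB0 β N σ = β ^ 2 / 2 * (N * mag σ ^ 2 - 1) := by
  have h : (N : ℝ) ≠ 0 := by positivity
  have := sum_ss_off σ
  have e : skB0 β N σ = (β / Real.sqrt (2 * (N : ℝ))) ^ 2 *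
      ∑ p : Fin N × Fin N, if p.1 ≠ p.2 then spin σ p.1 * spin σ p.2 else 0 := by
    unfold skB0
    rw [Finset.mul_sum]
    refine Finset.sum_congr rfl fun p _ => ?_
    split_ifs <;> simp
  rw [e, this, a0_sq, sum_spin hN]
  field_simp

lemma skUV (β : ℝ) (N : ℕ) (s : (Fin N → Bool) → ℝ) (p) :
    (∀ σ, skU β N p σ = 0) ∨ (∀ σ, skV β N s p σ = 0) := by
  rcases p with p | p
  · right; intro σ; rfl
  · left; intro σ; rfl

lemma Din_sk (β : ℝ) {N : ℕ} (hN : 0 < N) (s B1 : (Fin N → Bool) → ℝ) (θ : ℝ)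
    (g : (Fin N × Fin N) ⊕ Fin N → ℝ) :
    Din (skU β N) (skV β N s) (skB0 β N) B1 θ g =
      β ^ 2 / (2 * N) * ((N : ℝ) ^ 2 - ∑ p : Fin N × Fin N,
        gib (Hin (skU β N) (skV β N s) (skB0 β N) B1 θ g) (fun σ => spin σ p.1 * spin σ p.2) ^ 2)
      - β ^ 2 * (N * gib (Hin (skU β N) (skV β N s) (skB0 β N) B1 θ g) (fun σ => s σ * s σ)
        - ∑ i, gib (Hin (skU β N) (skV β N s) (skB0 β N) B1 θ g) (fun σ => s σ * spin σ i) ^ 2)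
      + β ^ 2 * (N * gib (Hin (skU β N) (skV β N s) (skB0 β N) B1 θ g) (fun σ => mag σ ^ 2) - 1)
      - 2 * gib (Hin (skU β N) (skV β N s) (skB0 β N) B1 θ g) B1 := by
  unfold Din
  set h := Hin (skU β N) (skV β N s) (skB0 β N) B1 θ g
  rw [Fintype.sum_sum_type]
  have e1 : ∀ p : Fin N × Fin N,
      (gib h (fun σ => skU β N (Sum.inl p) σ * skU β N (Sum.inl p) σ)
        - gib h (skU β N (Sum.inl p)) ^ 2)
      - (gib h (fun σ => skV β N s (Sum.inl p) σ * skV β N s (Sum.inl p) σ)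
        - gib h (skV β N s (Sum.inl p)) ^ 2)
      = β ^ 2 / (2 * N) * (1 - gib h (fun σ => spin σ p.1 * spin σ p.2) ^ 2) := by
    intro p
    have hv : gib h (skV β N s (Sum.inl p)) = 0 := gib_const h 0
    have hvv : gib h (fun σ => skV β N s (Sum.inl p) σ * skV β N s (Sum.inl p) σ) = 0 := by
      have : (fun σ => skV β N s (Sum.inl p) σ * skV β N s (Sum.inl p) σ) = fun _ => 0 := by
        ext σ; simp [skV]
      rw [this]; exact gib_const h 0
    rw [hv, hvv, ← a0_sq]
    by_cases hp : p.1 = p.2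
    · have hu : gib h (skU β N (Sum.inl p)) = 0 := by
        have : skU β N (Sum.inl p) = fun _ => 0 := by ext σ; simp [skU, hp]
        rw [this]; exact gib_const h 0
      have huu : gib h (fun σ => skU β N (Sum.inl p) σ * skU β N (Sum.inl p) σ) = 0 := by
        have : (fun σ => skU β N (Sum.inl p) σ * skU β N (Sum.inl p) σ) = fun _ => 0 := by
          ext σ; simp [skU, hp]
        rw [this]; exact gib_const h 0
      have h1 : gib h (fun σ => spin σ p.1 * spin σ p.2) = 1 := by
        have : (fun σ => spin σ p.1 * spin σ p.2) = fun _ => 1 := by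
          ext σ; rw [hp, spin_sq]
        rw [this]; exact gib_const h 1
      rw [hu, huu, h1]; ring
    · have hu : gib h (skU β N (Sum.inl p)) = β / Real.sqrt (2 * (N : ℝ)) *
          gib h (fun σ => spin σ p.1 * spin σ p.2) := by
        rw [← gib_mul]; congr 1; ext σ; simp [skU, hp]
      have huu : gib h (fun σ => skU β N (Sum.inl p) σ * skU β N (Sum.inl p) σ) =
          (β / Real.sqrt (2 * (N : ℝ))) ^ 2 := by
        rw [← gib_const h ((β / Real.sqrt (2 * (N : ℝ))) ^ 2)]; congr 1; ext σ
        simp only [skU, Sum.elim_inl, ne_eq, hp, not_false_eq_true, if_true]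
        have h1 := spin_sq σ p.1
        have h2 := spin_sq σ p.2
        calc _ = (β / Real.sqrt (2 * (N : ℝ))) ^ 2 * ((spin σ p.1 * spin σ p.1) *
              (spin σ p.2 * spin σ p.2)) := by ring
          _ = _ := by rw [h1, h2]; ring
      rw [hu, huu]; ring
  have e2 : ∀ i : Fin N,
      (gib h (fun σ => skU β N (Sum.inr i) σ * skU β N (Sum.inr i) σ)
        - gib h (skU β N (Sum.inr i)) ^ 2)
      - (gib h (fun σ => skV β N s (Sum.inr i) σ * skV β N s (Sum.inr i) σ)
        - gib h (skV β N s (Sum.inr i)) ^ 2)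
      = - β ^ 2 * (gib h (fun σ => s σ * s σ) - gib h (fun σ => s σ * spin σ i) ^ 2) := by
    intro i
    have hu : gib h (skU β N (Sum.inr i)) = 0 := gib_const h 0
    have huu : gib h (fun σ => skU β N (Sum.inr i) σ * skU β N (Sum.inr i) σ) = 0 := by
      have : (fun σ => skU β N (Sum.inr i) σ * skU β N (Sum.inr i) σ) = fun _ => 0 := by
        ext σ; simp [skU]
      rw [this]; exact gib_const h 0
    have hv : gib h (skV β N s (Sum.inr i)) = β * gib h (fun σ => s σ * spin σ i) := by
      rw [← gib_mul]; rfl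
    have hvv : gib h (fun σ => skV β N s (Sum.inr i) σ * skV β N s (Sum.inr i) σ)
        = β ^ 2 * gib h (fun σ => s σ * s σ) := by
      rw [← gib_mul]; congr 1; ext σ
      simp only [skV, Sum.elim_inr]
      linear_combination (β ^ 2 * s σ * s σ) * spin_sq σ i
    rw [hu, huu, hv, hvv]; ring
  have e3 : gib h (skB0 β N) = β ^ 2 / 2 * (N * gib h (fun σ => mag σ ^ 2) - 1) := by
    have : skB0 β N = fun σ => β ^ 2 / 2 * (N * mag σ ^ 2 - 1) := by
      ext σ; exact skB0_eq β hN σ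
    rw [this, gib_mul, gib_sub, gib_mul, gib_const]
  simp only [e1, e2, e3]
  simp only [← Finset.mul_sum, Finset.sum_sub_distrib]
  simp
  ring

lemma two_rep {N : ℕ} (h s : (Fin N → Bool) → ℝ) :
    0 ≤ ∑ p : Fin N × Fin N, gib h (fun σ => spin σ p.1 * spin σ p.2) ^ 2
      - 2 * N * ∑ i, gib h (fun σ => s σ * spin σ i) ^ 2
      + (N : ℝ) ^ 2 * gib h (fun σ => s σ * s σ) ^ 2 := by
  have e : ∑ p : Fin N × Fin N, gib h (fun σ => spin σ p.1 * spin σ p.2) ^ 2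
      - 2 * N * ∑ i, gib h (fun σ => s σ * spin σ i) ^ 2
      + (N : ℝ) ^ 2 * gib h (fun σ => s σ * s σ) ^ 2 =
      gib h (fun σ => gib h (fun τ => (∑ i, spin σ i * spin τ i - N * s σ * s τ) ^ 2)) := by
    have : ∀ σ τ : Fin N → Bool, (∑ i, spin σ i * spin τ i - N * s σ * s τ) ^ 2 =
        ∑ p : Fin N × Fin N, (spin σ p.1 * spin σ p.2) * (spin τ p.1 * spin τ p.2)
        - 2 * N * ∑ i, (s σ * spin σ i) * (s τ * spin τ i)
        + N ^ 2 * ((s σ * s σ) * (s τ * s τ)) := by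
      intro σ τ
      have e1 : ∑ p : Fin N × Fin N, (spin σ p.1 * spin σ p.2) * (spin τ p.1 * spin τ p.2)
          = (∑ i, spin σ i * spin τ i) ^ 2 := by
        rw [sq, Finset.sum_mul_sum, Fintype.sum_prod_type]
        exact Finset.sum_congr rfl fun i _ => Finset.sum_congr rfl fun j _ => by ring
      have e2 : ∑ i, (s σ * spin σ i) * (s τ * spin τ i) = s σ * s τ * ∑ i, spin σ i * spin τ i := by
        rw [Finset.mul_sum]; exact Finset.sum_congr rfl fun i _ => by ring
      rw [e1, e2]; ring
    simp only [this]
    simp only [sq (gib h _), gib_mul_gib, gib_add, gib_sub, gib_sum, gib_mul]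
  rw [e, ← gib_const h 0]
  refine gib_mono _ fun σ => ?_
  rw [← gib_const h 0]
  exact gib_mono _ fun τ => sq_nonneg _

lemma gib_jensen {S : Type*} [Fintype S] [Nonempty S] (h f : S → ℝ) :
    gib h f ^ 2 ≤ gib h (fun σ => f σ ^ 2) := by
  have h0 : 0 ≤ gib h (fun σ => (f σ - gib h f) ^ 2) := by
    rw [← gib_const h 0]
    exact gib_mono _ fun τ => sq_nonneg _
  have e : (fun σ => (f σ - gib h f) ^ 2) =
      fun σ => (f σ ^ 2 - 2 * gib h f * f σ) + gib h f ^ 2 := by ext; ring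
  rw [e, gib_add, gib_sub, gib_mul, gib_const] at h0
  nlinarith

lemma sum_exp_spin {N : ℕ} (x : Fin N → ℝ) :
    ∑ σ : Fin N → Bool, Real.exp (∑ i, x i * spin σ i) = ∏ i, (2 * Real.cosh (x i)) := by
  have : ∀ i, 2 * Real.cosh (x i) = ∑ b : Bool, Real.exp (x i * if b then 1 else -1) := by
    intro i; simp [Real.cosh_eq]; ring
  simp only [this]
  rw [Finset.prod_univ_sum, Fintype.piFinset_univ]
  refine Finset.sum_congr rfl fun σ _ => ?_
  rw [Real.exp_sum]; rfl

section marg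
variable {P Q : Type*} [Fintype P] [Fintype Q]

lemma mp_inl : MeasurePreserving (fun (g : P ⊕ Q → ℝ) p => g (Sum.inl p)) (gpi (P ⊕ Q)) (gpi P) := by
  have h := measurePreserving_sumPiEquivProdPi (fun _ : P ⊕ Q => gaussianReal 0 1)
  exact measurePreserving_fst.comp h

lemma mp_inr : MeasurePreserving (fun (g : P ⊕ Q → ℝ) p => g (Sum.inr p)) (gpi (P ⊕ Q)) (gpi Q) := by
  have h := measurePreserving_sumPiEquivProdPi (fun _ : P ⊕ Q => gaussianReal 0 1)
  exact measurePreserving_snd.comp h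
end marg

lemma Ain_end (β : ℝ) (N : ℕ) (s B1 : (Fin N → Bool) → ℝ) :
    Ain (skU β N) (skV β N s) (skB0 β N) B1 (Real.pi / 2) = skTarget β N := by
  unfold Ain skTarget
  set a := β / Real.sqrt (2 * (N : ℝ))
  set F : (Fin N × Fin N → ℝ) → ℝ := fun J => Real.log (∑ σ : Fin N → Bool, Real.exp
      (∑ p ∈ Finset.univ.filter (fun p : Fin N × Fin N => p.1 ≠ p.2),
        a * J p * spin σ p.1 * spin σ p.2)) with hF
  have hFm : Measurable F := by simp only [hF]; fun_prop
  rw [← (mp_shift (fun _ : Fin N × Fin N => a)).map_eq, integral_map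
    (mp_shift (fun _ : Fin N × Fin N => a)).measurable.aemeasurable hFm.aestronglyMeasurable,
    ← (mp_inl (P := Fin N × Fin N) (Q := Fin N)).map_eq, integral_map
      mp_inl.measurable.aemeasurable (by exact (by fun_prop : Measurable _).aestronglyMeasurable)]
  congr 1; ext g
  simp only [hF]
  congr 1
  refine Finset.sum_congr rfl fun σ _ => ?_
  congr 1
  unfold Hin skB0
  simp only [Real.sin_pi_div_two, Real.cos_pi_div_two, Fintype.sum_sum_type]
  rw [Finset.sum_filter]
  simp only [skU, Sum.elim_inl, Sum.elim_inr, zero_mul, one_mul, Finset.sum_const_zero, add_zero,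
    one_pow, ne_eq, OfNat.ofNat_ne_zero, not_false_eq_true, zero_pow]
  rw [← Finset.sum_add_distrib]
  refine Finset.sum_congr rfl fun p _ => ?_
  split_ifs
  · ring
  · ring

lemma Ain_start (β : ℝ) (N : ℕ) (s B1 : (Fin N → Bool) → ℝ) :
    Ain (skU β N) (skV β N s) (skB0 β N) B1 0 =
      ∫ y, Real.log (∑ σ : Fin N → Bool,
        Real.exp (∑ i, β * (s σ * spin σ i) * y i + B1 σ)) ∂(gpi (Fin N)) := by
  unfold Ain
  rw [← (mp_inr (P := Fin N × Fin N) (Q := Fin N)).map_eq, integral_map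
      mp_inr.measurable.aemeasurable (by exact (by fun_prop : Measurable _).aestronglyMeasurable)]
  congr 1; ext g
  congr 1
  refine Finset.sum_congr rfl fun σ _ => ?_
  congr 1
  unfold Hin
  simp [Fintype.sum_sum_type, skV]
end sk

section lower

lemma gib_add_const {S : Type*} [Fintype S] (h f : S → ℝ) (c : ℝ) :
    gib (fun σ => h σ + c) f = gib h f := by
  unfold gib
  simp only [Real.exp_add]
  have e : ∑ σ, Real.exp (h σ) * Real.exp c * f σ = (∑ σ, Real.exp (h σ) * f σ) * Real.exp c := by
    rw [Finset.sum_mul]; exact Finset.sum_congr rfl fun σ _ => by ring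
  rw [e, ← Finset.sum_mul, mul_div_mul_right _ _ (Real.exp_pos c).ne']

/-- characters -/
noncomputable def skChi (N : ℕ) : (Fin N × Fin N) ⊕ Fin N → (Fin N → Bool) → ℝ :=
  Sum.elim (fun p σ => spin σ p.1 * spin σ p.2) (fun i σ => spin σ i)

lemma spin_op {N : ℕ} (τ σ : Fin N → Bool) (i : Fin N) :
    spin (fun j => τ j == σ j) i = spin τ i * spin σ i := by
  unfold spin
  cases h1 : τ i <;> cases h2 : σ i <;> simp [h1, h2]

lemma integrable_log_cosh (a b : ℝ) :
    Integrable (fun y : ℝ => Real.log (2 * Real.cosh (a * y + b))) (gaussianReal 0 1) := by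
  have hb : Integrable (fun y : ℝ => |a| * |y| + |b| + Real.log 2) (gaussianReal 0 1) :=
    ((integrable_abs_gauss.const_mul _).add (integrable_const _)).add (integrable_const _)
  refine hb.mono' ?_ (ae_of_all _ fun y => ?_)
  · have : Continuous (fun y : ℝ => 2 * Real.cosh (a * y + b)) := by fun_prop
    exact (Real.measurable_log.comp this.measurable).aestronglyMeasurable
  · have h1 := Real.one_le_cosh (a * y + b)
    rw [Real.norm_eq_abs, abs_of_nonneg (Real.log_nonneg (by linarith)),
      Real.log_mul (by norm_num) (by linarith)]
    have h2 : Real.cosh (a * y + b) ≤ Real.exp |a * y + b| := by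
      rw [← Real.cosh_abs, Real.cosh_eq]
      have : Real.exp (-|a * y + b|) ≤ Real.exp |a * y + b| :=
        Real.exp_le_exp.2 (by linarith [abs_nonneg (a * y + b)])
      linarith
    have h3 := Real.log_le_log (by linarith) h2
    rw [Real.log_exp] at h3
    have h4 := abs_add_le (a * y) b
    rw [abs_mul] at h4
    linarith

variable (β q : ℝ) (N : ℕ)

/-- site drift for the lower bound -/
noncomputable def loB1 (σ : Fin N → Bool) : ℝ :=
  β ^ 2 * q * ∑ i, spin σ i + (N * (β ^ 2 / 4 * (1 - 2 * q - q ^ 2)) - β ^ 2 / 2)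

lemma lo_nish (hq : 0 ≤ q) (θ : ℝ) (r) :
    ∫ g, gib (Hin (skU β N) (skV β N (fun _ => Real.sqrt q)) (skB0 β N) (loB1 β q N) θ g)
      (skChi N r) ∂(gpi _) =
    ∫ g, gib (Hin (skU β N) (skV β N (fun _ => Real.sqrt q)) (skB0 β N) (loB1 β q N) θ g)
      (skChi N r) ^ 2 ∂(gpi _) := by
  set α : (Fin N × Fin N) ⊕ Fin N → ℝ := Sum.elim
    (fun p => if p.1 ≠ p.2 then Real.sin θ * (β / Real.sqrt (2 * (N : ℝ))) else 0)
    (fun _ => Real.cos θ * β * Real.sqrt q) with hα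
  have e : ∀ g, Hin (skU β N) (skV β N (fun _ => Real.sqrt q)) (skB0 β N) (loB1 β q N) θ g =
      fun σ => ∑ i, α i * skChi N i σ * (g i + α i)
        + Real.cos θ ^ 2 * (N * (β ^ 2 / 4 * (1 - 2 * q - q ^ 2)) - β ^ 2 / 2) := by
    intro g; ext σ
    unfold Hin skB0 loB1
    simp only [Fintype.sum_sum_type, skU, skV, skChi, hα, Sum.elim_inl, Sum.elim_inr, zero_mul,
      Finset.sum_const_zero, add_zero, zero_add]
    have e1 : ∑ p : Fin N × Fin N, (if p.1 ≠ p.2 then Real.sin θ * (β / Real.sqrt (2 * (N : ℝ))) else 0)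
        * (spin σ p.1 * spin σ p.2) * (g (Sum.inl p) +
          if p.1 ≠ p.2 then Real.sin θ * (β / Real.sqrt (2 * (N : ℝ))) else 0)
        = Real.sin θ * (∑ p : Fin N × Fin N, (if p.1 ≠ p.2 then
            β / Real.sqrt (2 * (N : ℝ)) * (spin σ p.1 * spin σ p.2) else 0) * g (Sum.inl p))
          + Real.sin θ ^ 2 * ∑ p : Fin N × Fin N, (if p.1 ≠ p.2 then
            (β / Real.sqrt (2 * (N : ℝ))) ^ 2 * (spin σ p.1 * spin σ p.2) else 0) := by
      rw [Finset.mul_sum, Finset.mul_sum, ← Finset.sum_add_distrib]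
      refine Finset.sum_congr rfl fun p _ => ?_
      split_ifs <;> ring
    have e2 : ∑ i, Real.cos θ * β * Real.sqrt q * spin σ i *
          (g (Sum.inr i) + Real.cos θ * β * Real.sqrt q)
        = Real.cos θ * (∑ i, β * (Real.sqrt q * spin σ i) * g (Sum.inr i))
          + Real.cos θ ^ 2 * (β ^ 2 * q * ∑ i, spin σ i) := by
      rw [Finset.mul_sum, Finset.mul_sum, Finset.mul_sum, ← Finset.sum_add_distrib]
      refine Finset.sum_congr rfl fun p _ => ?_
      linear_combination (Real.cos θ ^ 2 * β ^ 2 * spin σ p) * Real.mul_self_sqrt hq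
    rw [e1, e2]; ring
  simp only [e, gib_add_const]
  refine nishimori (skChi N) (fun τ σ j => τ j == σ j) (fun τ => ?_) ?_ ?_ α r
  · refine Function.Involutive.bijective fun σ => ?_
    funext j
    show (τ j == (τ j == σ j)) = σ j
    cases τ j <;> cases σ j <;> rfl
  · rintro (p | i) τ σ
    · simp only [skChi, Sum.elim_inl, spin_op]; ring
    · simp only [skChi, Sum.elim_inr, spin_op]
  · rintro (p | i) σ
    · simp only [skChi, Sum.elim_inl]
      linear_combination spin_sq σ p.1 * (spin σ p.2 * spin σ p.2) + spin_sq σ p.2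
    · exact spin_sq σ i

theorem sk_lower (hq : 0 ≤ q) (hN : 0 < N) :
    N * rsFunctional β q - β ^ 2 / 2 ≤ skTarget β N := by
  have hN' : (N : ℝ) ≠ 0 := by positivity
  have hNp : (0 : ℝ) < N := by positivity
  have key := Ain_mono (skU β N) (skV β N (fun _ => Real.sqrt q)) (skB0 β N) (loB1 β q N)
    (skUV β N _) ?_
  · rw [Ain_end, Ain_start] at key
    refine le_trans (le_of_eq ?_) key
    have e : ∀ y : Fin N → ℝ, Real.log (∑ σ : Fin N → Bool,
        Real.exp (∑ i, β * (Real.sqrt q * spin σ i) * y i + loB1 β q N σ)) =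
        ∑ i, Real.log (2 * Real.cosh (β * Real.sqrt q * y i + β ^ 2 * q))
          + (N * (β ^ 2 / 4 * (1 - 2 * q - q ^ 2)) - β ^ 2 / 2) := by
      intro y
      have : ∀ σ : Fin N → Bool, ∑ i, β * (Real.sqrt q * spin σ i) * y i + loB1 β q N σ =
          ∑ i, (β * Real.sqrt q * y i + β ^ 2 * q) * spin σ i
          + (N * (β ^ 2 / 4 * (1 - 2 * q - q ^ 2)) - β ^ 2 / 2) := by
        intro σ
        rw [loB1, ← add_assoc, Finset.mul_sum, ← Finset.sum_add_distrib]
        congr 1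
        exact Finset.sum_congr rfl fun i _ => by ring
      simp only [this, Real.exp_add _ (_ - _)]
      rw [← Finset.sum_mul, sum_exp_spin, Real.log_mul _ (Real.exp_pos _).ne', Real.log_exp,
        Real.log_prod]
      · intro i _; have := Real.cosh_pos (β * Real.sqrt q * y i + β ^ 2 * q); positivity
      · refine Finset.prod_ne_zero_iff.2 fun i _ => ?_
        have := Real.cosh_pos (β * Real.sqrt q * y i + β ^ 2 * q); positivity
    simp only [e]
    have hi := integrable_log_cosh (β * Real.sqrt q) (β ^ 2 * q)
    have hie : ∀ i : Fin N, Integrable (fun y : Fin N → ℝ =>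
        Real.log (2 * Real.cosh (β * Real.sqrt q * y i + β ^ 2 * q))) (gpi (Fin N)) := fun i =>
      integrable_comp_eval (μ := fun _ : Fin N => gaussianReal 0 1) (i := i) hi
    rw [integral_add (integrable_finsetSum _ fun i _ => hie i) (integrable_const _),
      integral_finsetSum _ fun i _ => hie i]
    have : ∀ i : Fin N, ∫ y : Fin N → ℝ,
        Real.log (2 * Real.cosh (β * Real.sqrt q * y i + β ^ 2 * q)) ∂(gpi (Fin N)) =
        ∫ y, Real.log (2 * Real.cosh (β * Real.sqrt q * y + β ^ 2 * q)) ∂(gaussianReal 0 1) :=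
      fun i => integral_comp_eval (μ := fun _ : Fin N => gaussianReal 0 1) (i := i)
        (f := fun y => Real.log (2 * Real.cosh (β * Real.sqrt q * y + β ^ 2 * q))) hi.1
    simp only [this]
    simp [rsFunctional]
    ring
  · intro θ
    have ns := lo_nish β q N hq θ
    have mg := measurable_gib_Hin (skU β N) (skV β N (fun _ => Real.sqrt q)) (skB0 β N)
      (loB1 β q N) θ
    set h : ((Fin N × Fin N) ⊕ Fin N → ℝ) → (Fin N → Bool) → ℝ :=
      Hin (skU β N) (skV β N (fun _ => Real.sqrt q)) (skB0 β N) (loB1 β q N) θ with hh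
    have bddint : ∀ f : (Fin N → Bool) → ℝ, Integrable (fun g => gib (h g) f) (gpi _) := by
      intro f
      obtain ⟨C, _, hC⟩ := exists_bound f
      exact Integrable.of_bound (mg f).aestronglyMeasurable C
        (ae_of_all _ fun g => gib_abs_le _ _ _ hC)
    have bddint2 : ∀ f : (Fin N → Bool) → ℝ, Integrable (fun g => gib (h g) f ^ 2) (gpi _) := by
      intro f
      obtain ⟨C, _, hC⟩ := exists_bound f
      refine Integrable.of_bound ((mg f).pow_const 2).aestronglyMeasurable (C ^ 2)
        (ae_of_all _ fun g => ?_)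
      rw [norm_pow]
      exact pow_le_pow_left₀ (norm_nonneg _) (gib_abs_le _ _ _ hC) 2
    set R : ((Fin N × Fin N) ⊕ Fin N → ℝ) → ℝ := fun g =>
      β ^ 2 / (2 * N) * (∑ p : Fin N × Fin N, gib (h g) (fun σ => spin σ p.1 * spin σ p.2) ^ 2
      - 2 * N * ∑ i, gib (h g) (fun σ => Real.sqrt q * spin σ i) ^ 2
      + (N : ℝ) ^ 2 * gib (h g) (fun _ => Real.sqrt q * Real.sqrt q) ^ 2) with hR
    have hRnn : ∀ g, 0 ≤ R g := fun g => mul_nonneg (by positivity) (two_rep (h g) _)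
    have eD : ∀ g, Din (skU β N) (skV β N (fun _ => Real.sqrt q)) (skB0 β N) (loB1 β q N) θ g =
        R g + ∑ p : Fin N × Fin N, β ^ 2 / N * (gib (h g) (skChi N (Sum.inl p)) -
            gib (h g) (skChi N (Sum.inl p)) ^ 2)
          + ∑ i : Fin N, (-(2 * β ^ 2 * q)) * (gib (h g) (skChi N (Sum.inr i)) -
            gib (h g) (skChi N (Sum.inr i)) ^ 2) := by
      intro g
      rw [Din_sk β hN, ← hh]
      have b1 : gib (h g) (loB1 β q N) = β ^ 2 * q * ∑ i, gib (h g) (skChi N (Sum.inr i))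
          + (N * (β ^ 2 / 4 * (1 - 2 * q - q ^ 2)) - β ^ 2 / 2) := by
        unfold loB1
        rw [gib_add, gib_mul, gib_sum, gib_const]; rfl
      have b2 : gib (h g) (fun σ => mag σ ^ 2) = (1 / (N : ℝ) ^ 2) *
          ∑ p : Fin N × Fin N, gib (h g) (skChi N (Sum.inl p)) := by
        rw [← gib_sum, ← gib_mul]
        congr 1; ext σ
        simp only [skChi, Sum.elim_inl, sum_ss, mag]
        field_simp
      have b3 : ∀ i, gib (h g) (fun σ => Real.sqrt q * spin σ i) ^ 2 =
          q * gib (h g) (skChi N (Sum.inr i)) ^ 2 := by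
        intro i
        rw [gib_mul, mul_pow, Real.sq_sqrt hq]; rfl
      have b4 : ∀ p : Fin N × Fin N, gib (h g) (fun σ => spin σ p.1 * spin σ p.2)
        = gib (h g) (skChi N (Sum.inl p)) := fun p => rfl
      simp only [hR, b1, b2, b3, b4, gib_const, Real.mul_self_sqrt hq, ← Finset.mul_sum,
        Finset.sum_sub_distrib]
      field_simp
      ring
    have i1 : ∀ r, Integrable (fun g => gib (h g) (skChi N r) - gib (h g) (skChi N r) ^ 2) (gpi _) :=
      fun r => (bddint _).sub (bddint2 _)
    have z1 : ∀ r, ∫ g, (gib (h g) (skChi N r) - gib (h g) (skChi N r) ^ 2) ∂(gpi _) = 0 := by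
      intro r
      rw [integral_sub (bddint _) (bddint2 _), ns r, sub_self]
    have iR : Integrable R (gpi _) :=
      (((integrable_finsetSum _ fun p _ => bddint2 _).sub
        ((integrable_finsetSum _ fun p _ => bddint2 _).const_mul _)).add
        ((bddint2 _).const_mul _)).const_mul _
    have iA : Integrable (fun g => ∑ p : Fin N × Fin N, β ^ 2 / N *
        (gib (h g) (skChi N (Sum.inl p)) - gib (h g) (skChi N (Sum.inl p)) ^ 2)) (gpi _) :=
      integrable_finsetSum _ fun p _ => (i1 _).const_mul _
    have iB : Integrable (fun g => ∑ i : Fin N, (-(2 * β ^ 2 * q)) *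
        (gib (h g) (skChi N (Sum.inr i)) - gib (h g) (skChi N (Sum.inr i)) ^ 2)) (gpi _) :=
      integrable_finsetSum _ fun p _ => (i1 _).const_mul _
    simp only [eD]
    have iRA : Integrable (fun g => R g + ∑ p : Fin N × Fin N, β ^ 2 / N *
        (gib (h g) (skChi N (Sum.inl p)) - gib (h g) (skChi N (Sum.inl p)) ^ 2)) (gpi _) :=
      iR.add iA
    rw [integral_add iRA iB, integral_add iR iA,
      integral_finsetSum _ fun p _ => (i1 _).const_mul _,
      integral_finsetSum _ fun p _ => (i1 _).const_mul _]
    simp only [integral_const_mul, z1, mul_zero, Finset.sum_const_zero, add_zero]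
    exact integral_nonneg hRnn
end lower

section upper

/-- quadratic correction of the site model -/
noncomputable def upK (β m : ℝ) : ℝ := β ^ 2 / 4 * (1 - 2 * |m| - m ^ 2)

/-- site drift for the upper bound -/
noncomputable def upB1 (β : ℝ) (N : ℕ) (σ : Fin N → Bool) : ℝ :=
  N * (β ^ 2 * mag σ ^ 2 + upK β (mag σ))

/-- one-site log-partition function -/
noncomputable def upL (β m y : ℝ) : ℝ :=
  Real.log (2 * Real.cosh (β * Real.sqrt |m| * y + β ^ 2 * m))

/-- dominating function -/
noncomputable def upW (β y : ℝ) : ℝ :=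
  8 * Real.exp (2 * β ^ 2) * (Real.exp (2 * β * y) + Real.exp (-(2 * β) * y))

lemma integrable_upW (β : ℝ) : Integrable (upW β) (gaussianReal 0 1) :=
  ((integrable_exp_mul_gaussianReal (μ := 0) (v := 1) (2 * β)).add
    (integrable_exp_mul_gaussianReal (μ := 0) (v := 1) (-(2 * β)))).const_mul _

lemma integrable_upL (β m : ℝ) : Integrable (upL β m) (gaussianReal 0 1) :=
  integrable_log_cosh _ _

lemma upL_nonneg (β m y : ℝ) : 0 ≤ upL β m y :=
  Real.log_nonneg (by linarith [Real.one_le_cosh (β * Real.sqrt |m| * y + β ^ 2 * m)])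

lemma exp_upL_sq (β m y : ℝ) (hβ : 0 < β) (hm : |m| ≤ 1) :
    8 * Real.exp (upL β m y) ^ 2 ≤ 4 * upW β y := by
  set x := β * Real.sqrt |m| * y + β ^ 2 * m with hx
  have hc := Real.cosh_pos x
  rw [upL, Real.exp_log (by positivity)]
  have h2 : Real.cosh x ≤ Real.exp |x| := by
    rw [← Real.cosh_abs, Real.cosh_eq]
    have : Real.exp (-|x|) ≤ Real.exp |x| := Real.exp_le_exp.2 (by linarith [abs_nonneg x])
    linarith
  have hs : Real.sqrt |m| ≤ 1 := Real.sqrt_le_one.2 hm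
  have hs0 := Real.sqrt_nonneg |m|
  have h3 : |x| ≤ β * |y| + β ^ 2 := by
    refine (abs_add_le _ _).trans (add_le_add ?_ ?_)
    · rw [abs_mul, abs_mul, abs_of_pos hβ, abs_of_nonneg hs0]
      have := abs_nonneg y
      nlinarith [mul_nonneg hβ.le this]
    · rw [abs_mul, abs_of_nonneg (sq_nonneg β)]
      nlinarith [sq_nonneg β]
  have h4 : Real.cosh x ^ 2 ≤ Real.exp (2 * β ^ 2) * Real.exp (2 * β * |y|) := by
    calc Real.cosh x ^ 2 ≤ Real.exp |x| ^ 2 := by gcongr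
      _ = Real.exp (2 * |x|) := by rw [← Real.exp_nat_mul]; norm_num
      _ ≤ Real.exp (2 * β ^ 2 + 2 * β * |y|) := Real.exp_le_exp.2 (by linarith)
      _ = _ := Real.exp_add _ _
  have h5 : Real.exp (2 * β * |y|) ≤ Real.exp (2 * β * y) + Real.exp (-(2 * β) * y) := by
    rcases abs_cases y with ⟨h, _⟩ | ⟨h, _⟩
    · rw [h]; linarith [Real.exp_pos (-(2 * β) * y)]
    · rw [h, mul_neg, ← neg_mul]; linarith [Real.exp_pos (2 * β * y)]
  have h6 := h4.trans (mul_le_mul_of_nonneg_left h5 (Real.exp_pos (2 * β ^ 2)).le)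
  unfold upW
  nlinarith

lemma exp_upL_le (β m y l : ℝ) (hβ : 0 < β) (hm : |m| ≤ 1) (hl : 0 < l) (hl1 : l ≤ 1) :
    Real.exp (l * upL β m y) ≤ 1 + l * upL β m y + l ^ 2 * upW β y := by
  have h0 := upL_nonneg β m y
  have h1 := exp_upL_sq β m y hβ hm
  set z := upL β m y
  have e0 : ∀ x : ℝ, Real.exp x ≤ 1 + x * Real.exp x := by
    intro x
    have h := Real.add_one_le_exp (-x)
    have h2 : Real.exp x * Real.exp (-x) = 1 := by rw [← Real.exp_add]; simp
    nlinarith [Real.exp_pos x]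
  have e1 := e0 (l * z)
  have e2 : Real.exp (l * z) ≤ 1 + l * z + (l * z) ^ 2 * Real.exp (l * z) := by
    have : 0 ≤ l * z := by positivity
    nlinarith
  have e3 : Real.exp (l * z) ≤ Real.exp z := Real.exp_le_exp.2 (by nlinarith)
  have e4 : z ^ 2 ≤ 2 * Real.exp z := by
    have := Real.quadratic_le_exp_of_nonneg h0
    linarith
  have e5 : z ^ 2 * Real.exp (l * z) ≤ 2 * Real.exp z * Real.exp z := by
    have := Real.exp_pos (l * z)
    have := Real.exp_pos z
    gcongr
  have e6 : z ^ 2 * Real.exp (l * z) ≤ upW β y := by nlinarith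
  have : l ^ 2 * (z ^ 2 * Real.exp (l * z)) ≤ l ^ 2 * upW β y :=
    mul_le_mul_of_nonneg_left e6 (sq_nonneg l)
  nlinarith

lemma measurable_upL (β m : ℝ) : Measurable (upL β m) := by
  have : Continuous (fun y : ℝ => 2 * Real.cosh (β * Real.sqrt |m| * y + β ^ 2 * m)) := by fun_prop
  exact Real.measurable_log.comp this.measurable

lemma integrable_exp_upL (β m l : ℝ) (hβ : 0 < β) (hm : |m| ≤ 1) (hl : 0 < l) (hl1 : l ≤ 1) :
    Integrable (fun y => Real.exp (l * upL β m y)) (gaussianReal 0 1) := by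
  have hb : Integrable (fun y => 1 + l * upL β m y + l ^ 2 * upW β y) (gaussianReal 0 1) :=
    ((integrable_const _).add ((integrable_upL β m).const_mul l)).add
      ((integrable_upW β).const_mul _)
  refine hb.mono' ?_ (ae_of_all _ fun y => ?_)
  · exact (Real.measurable_exp.comp ((measurable_upL β m).const_mul l)).aestronglyMeasurable
  · rw [Real.norm_eq_abs, abs_of_pos (Real.exp_pos _)]
    exact exp_upL_le β m y l hβ hm hl hl1

lemma integral_exp_upL (β m l : ℝ) (hβ : 0 < β) (hm : |m| ≤ 1) (hl : 0 < l) (hl1 : l ≤ 1) :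
    ∫ y, Real.exp (l * upL β m y) ∂(gaussianReal 0 1) ≤
      Real.exp (l * ((∫ y, upL β m y ∂(gaussianReal 0 1)) +
        l * ∫ y, upW β y ∂(gaussianReal 0 1))) := by
  have i1 : Integrable (fun y => 1 + l * upL β m y) (gaussianReal 0 1) :=
    (integrable_const _).add ((integrable_upL β m).const_mul l)
  have i2 : Integrable (fun y => l ^ 2 * upW β y) (gaussianReal 0 1) :=
    (integrable_upW β).const_mul _
  have h := integral_mono (integrable_exp_upL β m l hβ hm hl hl1) (i1.add i2)
    (fun y => exp_upL_le β m y l hβ hm hl hl1)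
  refine h.trans ?_
  have e : ∫ y, ((fun y => 1 + l * upL β m y) + fun y => l ^ 2 * upW β y) y ∂(gaussianReal 0 1)
      = 1 + l * (∫ y, upL β m y ∂(gaussianReal 0 1))
        + l ^ 2 * ∫ y, upW β y ∂(gaussianReal 0 1) := by
    simp only [Pi.add_apply]
    rw [integral_add i1 i2, integral_add (integrable_const _) ((integrable_upL β m).const_mul l),
      integral_const_mul, integral_const_mul]
    simp
  rw [e]
  have := Real.add_one_le_exp (l * ((∫ y, upL β m y ∂(gaussianReal 0 1)) +
        l * ∫ y, upW β y ∂(gaussianReal 0 1)))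
  linarith

lemma integral_upL_abs (β m : ℝ) :
    ∫ y, upL β m y ∂(gaussianReal 0 1) = ∫ y, upL β |m| y ∂(gaussianReal 0 1) := by
  rcases abs_cases m with ⟨h, _⟩ | ⟨h, _⟩
  · rw [h]
  · have hmap := gaussianReal_map_neg (μ := 0) (v := 1)
    rw [neg_zero] at hmap
    nth_rewrite 1 [← hmap]
    rw [integral_map measurable_neg.aemeasurable (measurable_upL β m).aestronglyMeasurable]
    refine integral_congr_ae (ae_of_all _ fun y => ?_)
    simp only [upL, abs_abs]
    rw [← Real.cosh_neg, h]
    ring_nf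

lemma upL_rs (β m : ℝ) :
    (∫ y, upL β m y ∂(gaussianReal 0 1)) + upK β m = rsFunctional β |m| := by
  rw [integral_upL_abs]
  unfold rsFunctional upK
  simp only [upL, abs_abs]
  rw [← sq_abs m]
  ring

lemma log_sum_bound {M : Type*} (s : Finset M) (hs : s.Nonempty) (X : M → ℝ) (l : ℝ) (hl : 0 < l) :
    Real.log (∑ m ∈ s, Real.exp (X m)) ≤
      Real.log s.card + (1 / l) * Real.log (∑ m ∈ s, Real.exp (l * X m)) := by
  obtain ⟨m0, hm0, hmax⟩ := s.exists_max_image X hs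
  have hc : (0 : ℝ) < s.card := by exact_mod_cast hs.card_pos
  have h1 : ∑ m ∈ s, Real.exp (X m) ≤ s.card * Real.exp (X m0) := by
    rw [← nsmul_eq_mul]
    exact Finset.sum_le_card_nsmul _ _ _ fun m hm => Real.exp_le_exp.2 (hmax m hm)
  have h2 := Real.log_le_log (Finset.sum_pos (fun m _ => Real.exp_pos (X m)) hs) h1
  rw [Real.log_mul hc.ne' (Real.exp_pos _).ne', Real.log_exp] at h2
  have h3 : Real.exp (l * X m0) ≤ ∑ m ∈ s, Real.exp (l * X m) :=
    Finset.single_le_sum (f := fun m => Real.exp (l * X m)) (fun m _ => (Real.exp_pos _).le) hm0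
  have h4 := Real.log_le_log (Real.exp_pos _) h3
  rw [Real.log_exp] at h4
  have h5 : X m0 ≤ (1 / l) * Real.log (∑ m ∈ s, Real.exp (l * X m)) := by
    rw [one_div, ← div_eq_inv_mul, le_div_iff₀ hl]; linarith
  linarith

/-- the possible magnetisations -/
noncomputable def magVal (N k : ℕ) : ℝ := (2 * k - N) / N

lemma mk_abs {N k : ℕ} (hN : 0 < N) (hk : k ∈ Finset.range (N + 1)) : |magVal N k| ≤ 1 := by
  have hNp : (0 : ℝ) < N := by positivity
  have hk' : (k : ℝ) ≤ N := by
    exact_mod_cast Nat.lt_succ_iff.1 (Finset.mem_range.1 hk)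
  have hk0 : (0 : ℝ) ≤ k := by positivity
  rw [magVal, abs_div, abs_of_pos hNp, div_le_one hNp, abs_le]
  constructor <;> linarith

lemma exists_mk {N : ℕ} (σ : Fin N → Bool) : ∃ k ∈ Finset.range (N + 1), mag σ = magVal N k := by
  refine ⟨(Finset.univ.filter fun i => σ i = true).card, ?_, ?_⟩
  · rw [Finset.mem_range, Nat.lt_succ_iff]
    simpa using Finset.card_le_univ (Finset.univ.filter fun i => σ i = true)
  · unfold mag magVal
    congr 1
    have : ∀ i, spin σ i = 2 * (if σ i = true then 1 else 0) - 1 := by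
      intro i; unfold spin; split_ifs <;> norm_num
    simp only [this, Finset.sum_sub_distrib, ← Finset.mul_sum]
    simp

theorem sk_upper_interp (β : ℝ) (N : ℕ) (hN : 0 < N) :
    skTarget β N ≤ ∫ y, Real.log (∑ σ : Fin N → Bool,
        Real.exp (∑ i, β * (Real.sqrt |mag σ| * spin σ i) * y i + upB1 β N σ)) ∂(gpi (Fin N)) := by
  have hNp : (0 : ℝ) < N := by positivity
  have key := Ain_anti (skU β N) (skV β N (fun σ => Real.sqrt |mag σ|)) (skB0 β N) (upB1 β N)
    (skUV β N _) ?_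
  · rwa [Ain_end, Ain_start] at key
  · intro θ
    refine integral_nonpos fun g => ?_
    rw [Din_sk β hN]
    set h := Hin (skU β N) (skV β N (fun σ => Real.sqrt |mag σ|)) (skB0 β N) (upB1 β N) θ g
    have t := two_rep h (fun σ => Real.sqrt |mag σ|)
    have j := gib_jensen h (fun σ => |mag σ|)
    simp only [Real.mul_self_sqrt (abs_nonneg _), sq_abs] at t j ⊢
    have b : gib h (upB1 β N) = N * (β ^ 2 * gib h (fun σ => mag σ ^ 2) + β ^ 2 / 4 *
        (1 - 2 * gib h (fun σ => |mag σ|) - gib h (fun σ => mag σ ^ 2))) := by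
      unfold upB1 upK
      rw [gib_mul, gib_add, gib_mul, gib_mul, gib_sub, gib_sub, gib_const, gib_mul]
    rw [b]
    have t2 := mul_nonneg (by positivity : 0 ≤ β ^ 2 / (2 * (N : ℝ))) t
    have j2 := mul_le_mul_of_nonneg_left j (by positivity : 0 ≤ N * β ^ 2 / 2)
    have e : β ^ 2 / (2 * (N : ℝ)) * (N : ℝ) ^ 2 = N * β ^ 2 / 2 := by field_simp
    have e2 : β ^ 2 / (2 * (N : ℝ)) * (2 * N) = β ^ 2 := by field_simp
    set A := ∑ p : Fin N × Fin N, gib h (fun σ => spin σ p.1 * spin σ p.2) ^ 2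
    set B := ∑ i, gib h (fun σ => Real.sqrt |mag σ| * spin σ i) ^ 2
    set C := gib h (fun σ => |mag σ|)
    set D := gib h (fun σ => mag σ ^ 2)
    have t3 : 0 ≤ β ^ 2 / (2 * (N : ℝ)) * A - β ^ 2 * B + N * β ^ 2 / 2 * C ^ 2 := by
      have : β ^ 2 / (2 * (N : ℝ)) * (A - 2 * N * B + N ^ 2 * C ^ 2) =
        β ^ 2 / (2 * (N : ℝ)) * A - β ^ 2 * B + N * β ^ 2 / 2 * C ^ 2 := by
        linear_combination C ^ 2 * e - B * e2
      linarith
    have t4 : β ^ 2 / (2 * (N : ℝ)) * ((N : ℝ) ^ 2 - A) =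
      N * β ^ 2 / 2 - β ^ 2 / (2 * (N : ℝ)) * A := by rw [mul_sub, e]
    show _ ≤ (0 : ℝ)
    rw [t4]
    nlinarith [sq_nonneg β]

theorem sk_upper (β ψ l : ℝ) (N : ℕ) (hβ : 0 < β) (hN : 0 < N) (hl : 0 < l) (hl1 : l ≤ 1)
    (hψ : ∀ q : ℝ, 0 ≤ q → rsFunctional β q ≤ ψ) :
    skTarget β N ≤ (1 + 1 / l) * Real.log (N + 1) +
      N * (ψ + l * ∫ y, upW β y ∂(gaussianReal 0 1)) := by
  have hNp : (0 : ℝ) < N := by positivity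
  refine (sk_upper_interp β N hN).trans ?_
  set K := ∫ y, upW β y ∂(gaussianReal 0 1)
  set S := Finset.range (N + 1) with hS
  have hSn : S.Nonempty := ⟨0, by simp [hS]⟩
  set X : ℕ → (Fin N → ℝ) → ℝ := fun k y => N * upK β (magVal N k) + ∑ i, upL β (magVal N k) (y i) with hX
  set C : ℝ := (N + 1) * Real.exp (l * (N * (ψ + l * K))) with hC
  have hCpos : 0 < C := by positivity
  -- pointwise bound
  have pw : ∀ y : Fin N → ℝ, Real.log (∑ σ : Fin N → Bool,
        Real.exp (∑ i, β * (Real.sqrt |mag σ| * spin σ i) * y i + upB1 β N σ)) ≤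
      Real.log (N + 1) + (1 / l) * (Real.log C + (∑ k ∈ S, Real.exp (l * X k y)) / C - 1) := by
    intro y
    have h1 : ∑ σ : Fin N → Bool,
        Real.exp (∑ i, β * (Real.sqrt |mag σ| * spin σ i) * y i + upB1 β N σ) ≤
        ∑ k ∈ S, Real.exp (X k y) := by
      have hx : ∀ k, Real.exp (X k y) = ∑ σ : Fin N → Bool, Real.exp (∑ i,
          (β * Real.sqrt |magVal N k| * y i + β ^ 2 * magVal N k) * spin σ i + N * upK β (magVal N k)) := by
        intro k
        simp only [Real.exp_add, ← Finset.sum_mul]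
        rw [sum_exp_spin, mul_comm]
        simp only [hX, Real.exp_add, Real.exp_sum, upL]
        congr 1
        refine Finset.prod_congr rfl fun i _ => ?_
        rw [Real.exp_log (by have := Real.cosh_pos (β * Real.sqrt |magVal N k| * y i + β ^ 2 * magVal N k); positivity)]
      simp only [hx]
      rw [Finset.sum_comm]
      refine Finset.sum_le_sum fun σ _ => ?_
      obtain ⟨k, hk, hkm⟩ := exists_mk σ
      refine le_trans (le_of_eq ?_) (Finset.single_le_sum (f := fun k => Real.exp (∑ i,
          (β * Real.sqrt |magVal N k| * y i + β ^ 2 * magVal N k) * spin σ i + N * upK β (magVal N k)))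
          (fun _ _ => (Real.exp_pos _).le) hk)
      simp only [← hkm]
      congr 1
      have : ∑ i, (β * Real.sqrt |mag σ| * y i + β ^ 2 * mag σ) * spin σ i =
          ∑ i, β * (Real.sqrt |mag σ| * spin σ i) * y i + β ^ 2 * mag σ * ∑ i, spin σ i := by
        rw [Finset.mul_sum, ← Finset.sum_add_distrib]
        exact Finset.sum_congr rfl fun i _ => by ring
      rw [this, sum_spin hN, upB1]
      ring
    have h2 := Real.log_le_log (Finset.sum_pos (fun σ _ => Real.exp_pos _)
      Finset.univ_nonempty) h1
    have h3 := log_sum_bound S hSn (fun k => X k y) l hl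
    have hcard : (S.card : ℝ) = N + 1 := by simp [hS]
    rw [hcard] at h3
    have hY : 0 < ∑ k ∈ S, Real.exp (l * X k y) := Finset.sum_pos (fun m _ => Real.exp_pos _) hSn
    have h4 : Real.log (∑ k ∈ S, Real.exp (l * X k y)) ≤
        Real.log C + (∑ k ∈ S, Real.exp (l * X k y)) / C - 1 := by
      have := Real.log_le_sub_one_of_pos (div_pos hY hCpos)
      rw [Real.log_div hY.ne' hCpos.ne'] at this
      linarith
    have h5 := mul_le_mul_of_nonneg_left h4 (by positivity : 0 ≤ 1 / l)
    linarith
  have eX : ∀ k y, Real.exp (l * X k y) =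
      Real.exp (l * (N * upK β (magVal N k))) * ∏ i, Real.exp (l * upL β (magVal N k) (y i)) := by
    intro k y
    rw [← Real.exp_sum, ← Real.exp_add]
    simp only [hX, mul_add, Finset.mul_sum]
  have iX : ∀ k ∈ S, Integrable (fun y => Real.exp (l * X k y)) (gpi (Fin N)) := by
    intro k hk
    simp only [eX]
    exact (Integrable.fintype_prod (f := fun (_ : Fin N) y => Real.exp (l * upL β (magVal N k) y))
      fun _ => integrable_exp_upL β _ l hβ (mk_abs hN hk) hl hl1).const_mul _
  have bX : ∀ k ∈ S, ∫ y, Real.exp (l * X k y) ∂(gpi (Fin N)) ≤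
      Real.exp (l * (N * (ψ + l * K))) := by
    intro k hk
    simp only [eX]
    rw [integral_const_mul, integral_fintype_prod_eq_pow (fun y => Real.exp (l * upL β (magVal N k) y)),
      Fintype.card_fin]
    have hnn : 0 ≤ ∫ y, Real.exp (l * upL β (magVal N k) y) ∂(gaussianReal 0 1) :=
      integral_nonneg fun y => (Real.exp_pos _).le
    have h1 := pow_le_pow_left₀ hnn (integral_exp_upL β (magVal N k) l hβ (mk_abs hN hk) hl hl1) N
    rw [← Real.exp_nat_mul] at h1
    refine (mul_le_mul_of_nonneg_left h1 (Real.exp_pos _).le).trans ?_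
    rw [← Real.exp_add, Real.exp_le_exp]
    have h2 := hψ |magVal N k| (abs_nonneg _)
    rw [← upL_rs] at h2
    have h3 := mul_le_mul_of_nonneg_left h2 (by positivity : 0 ≤ l * N)
    show l * (N * upK β (magVal N k)) + N * (l * (_ + l * K)) ≤ _
    linarith
  have iS : Integrable (fun y => ∑ k ∈ S, Real.exp (l * X k y)) (gpi (Fin N)) :=
    integrable_finsetSum _ iX
  have bS : ∫ y, ∑ k ∈ S, Real.exp (l * X k y) ∂(gpi (Fin N)) ≤ C := by
    rw [integral_finsetSum _ iX]
    refine (Finset.sum_le_card_nsmul _ _ _ bX).trans ?_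
    simp [hS, hC]
  have iL : Integrable (fun y : Fin N → ℝ => Real.log (∑ σ : Fin N → Bool,
        Real.exp (∑ i, β * (Real.sqrt |mag σ| * spin σ i) * y i + upB1 β N σ))) (gpi (Fin N)) := by
    have := integrable_logZ (fun (i : Fin N) (σ : Fin N → Bool) =>
      β * (Real.sqrt |mag σ| * spin σ i)) (fun _ _ => 0) (upB1 β N) (upB1 β N) (Real.pi / 2)
    simpa [Hin] using this
  have iR1 : Integrable (fun y : Fin N → ℝ => Real.log C +
      (∑ k ∈ S, Real.exp (l * X k y)) / C - 1) (gpi (Fin N)) :=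
    ((integrable_const _).add (iS.div_const C)).sub (integrable_const _)
  have iR : Integrable (fun y : Fin N → ℝ => Real.log (N + 1) + (1 / l) * (Real.log C +
      (∑ k ∈ S, Real.exp (l * X k y)) / C - 1)) (gpi (Fin N)) :=
    (integrable_const _).add (iR1.const_mul _)
  refine (integral_mono iL iR pw).trans ?_
  have iR2 : Integrable (fun y : Fin N → ℝ => Real.log C +
      (∑ k ∈ S, Real.exp (l * X k y)) / C) (gpi (Fin N)) :=
    (integrable_const _).add (iS.div_const C)
  rw [integral_add (integrable_const _) (iR1.const_mul _), integral_const_mul,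
    integral_sub iR2 (integrable_const _), integral_add (integrable_const _) (iS.div_const C),
    integral_div]
  simp only [integral_const, probReal_univ, one_smul]
  have h1 : (∫ y, ∑ k ∈ S, Real.exp (l * X k y) ∂(gpi (Fin N))) / C ≤ 1 :=
    (div_le_one hCpos).2 bS
  have hlogC : Real.log C = Real.log (N + 1) + l * (N * (ψ + l * K)) := by
    rw [hC, Real.log_mul (by positivity) (Real.exp_pos _).ne', Real.log_exp]
  have h2 : (1 / l) * (Real.log C + (∫ y, ∑ k ∈ S, Real.exp (l * X k y) ∂(gpi (Fin N))) / C - 1)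
      ≤ (1 / l) * Real.log C := mul_le_mul_of_nonneg_left (by linarith) (by positivity)
  have h3 : (1 / l) * Real.log C = (1 / l) * Real.log (N + 1) + N * (ψ + l * K) := by
    rw [hlogC]; field_simp
  linarith
end upper

section final

lemma sk_limit (β ψ q : ℝ) (hβ : 0 < β) (hq : 0 ≤ q) (hψ : rsFunctional β q = ψ)
    (hmax : ∀ q : ℝ, 0 ≤ q → rsFunctional β q ≤ ψ) :
    Tendsto (fun N : ℕ => (1 / (N : ℝ)) * skTarget β N) atTop (𝓝 ψ) := by
  set K := ∫ y, upW β y ∂(gaussianReal 0 1)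
  have hx : Tendsto (fun N : ℕ => Real.sqrt (Real.sqrt (N : ℝ))) atTop atTop :=
    Real.tendsto_sqrt_atTop.comp (Real.tendsto_sqrt_atTop.comp tendsto_natCast_atTop_atTop)
  have hxi : Tendsto (fun N : ℕ => (Real.sqrt (Real.sqrt (N : ℝ)))⁻¹) atTop (𝓝 0) :=
    tendsto_inv_atTop_zero.comp hx
  have hni : Tendsto (fun N : ℕ => ((N : ℝ))⁻¹) atTop (𝓝 0) :=
    tendsto_inv_atTop_zero.comp tendsto_natCast_atTop_atTop
  have lo : Tendsto (fun N : ℕ => ψ - β ^ 2 / 2 * ((N : ℝ))⁻¹) atTop (𝓝 ψ) := by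
    simpa using (hni.const_mul (β ^ 2 / 2)).const_sub ψ
  have up : Tendsto (fun N : ℕ => ψ + 8 * (Real.sqrt (Real.sqrt (N : ℝ)))⁻¹
      + K * ((Real.sqrt (Real.sqrt (N : ℝ)))⁻¹) ^ 2) atTop (𝓝 ψ) := by
    simpa using ((hxi.const_mul 8).const_add ψ).add ((hxi.pow 2).const_mul K)
  refine tendsto_of_tendsto_of_tendsto_of_le_of_le' lo up ?_ ?_
  · filter_upwards [eventually_gt_atTop 0] with N hN
    have hNp : (0 : ℝ) < N := by positivity
    have h := sk_lower β q N hq hN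
    rw [hψ] at h
    have h2 := mul_le_mul_of_nonneg_left h (by positivity : 0 ≤ 1 / (N : ℝ))
    refine le_trans (le_of_eq ?_) h2
    field_simp
  · filter_upwards [eventually_gt_atTop 0] with N hN
    have hN1 : (1 : ℝ) ≤ N := by exact_mod_cast hN
    have hNp : (0 : ℝ) < N := by positivity
    set x := Real.sqrt (Real.sqrt (N : ℝ)) with hxdef
    have hx1 : 1 ≤ x := by
      rw [hxdef, Real.one_le_sqrt, Real.one_le_sqrt]; exact hN1
    have hx0 : 0 < x := by linarith
    have hx4 : (N : ℝ) = x ^ 4 := by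
      have h1 : x ^ 2 = Real.sqrt N := Real.sq_sqrt (Real.sqrt_nonneg _)
      have h2 : Real.sqrt (N : ℝ) ^ 2 = N := Real.sq_sqrt hNp.le
      rw [← h2, ← h1]; ring
    have h := sk_upper β ψ (1 / x ^ 2) N hβ hN (by positivity)
      (by rw [div_le_one (by positivity)]; nlinarith) hmax
    have hlog : Real.log (N + 1) ≤ 4 * x := by
      have h1 : (N : ℝ) + 1 ≤ (1 + x) ^ 4 := by rw [hx4]; nlinarith [pow_pos hx0 3, pow_pos hx0 2]
      have h2 := Real.log_le_log (by positivity) h1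
      rw [Real.log_pow] at h2
      have h3 := Real.log_le_sub_one_of_pos (by linarith : 0 < 1 + x)
      push_cast at h2
      linarith
    have hcoef : (1 + 1 / (1 / x ^ 2)) ≤ 2 * x ^ 2 := by
      rw [one_div_one_div]; nlinarith
    have hlog0 : 0 ≤ Real.log (N + 1) := Real.log_nonneg (by linarith)
    have h5 : (1 + 1 / (1 / x ^ 2)) * Real.log (N + 1) ≤ 2 * x ^ 2 * (4 * x) :=
      mul_le_mul hcoef hlog hlog0 (by positivity)
    have h6 : skTarget β N ≤ 2 * x ^ 2 * (4 * x) + N * (ψ + 1 / x ^ 2 * K) := by linarith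
    have h7 := mul_le_mul_of_nonneg_left h6 (by positivity : 0 ≤ 1 / (N : ℝ))
    refine h7.trans (le_of_eq ?_)
    rw [hx4]
    field_simp
    ring

end final

/-- the quenched pressure of the SK model on the Nishimori line (couplings
`J_{ij}` i.i.d. `N(β/√(2 L^d), 1)`, exponent `(β/√(2 L^d)) Σ_{i≠j} J_{ij} σ_i σ_j`)
converges, as `L → ∞`, to the replica-symmetric value
`∫ Dy log 2cosh(β√q y + β²q) + (β²/4)(1-q)² - β²q²/2`, where `q` solves the fixed-point
equation `q = ∫ Dy tanh(β√q y + β²q)` (the maximizing solution). -/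
theorem sk_free_energy_nishimori (d : ℕ) (hd : 0 < d) (β q : ℝ) (hβ : 0 < β) (hq : 0 ≤ q)
    (hfix : q = ∫ y, Real.tanh (β * Real.sqrt q * y + β ^ 2 * q) ∂(gaussianReal 0 1))
    (hmax : ∀ q' : ℝ, 0 ≤ q' → rsFunctional β q' ≤ rsFunctional β q) :
    Tendsto (fun L : ℕ => (1 / ((L : ℝ) ^ d)) *
        ∫ J : Fin (L ^ d) × Fin (L ^ d) → ℝ,
          Real.log (∑ σ : Fin (L ^ d) → Bool, Real.exp
            (∑ p ∈ Finset.univ.filter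
                (fun p : Fin (L ^ d) × Fin (L ^ d) => p.1 ≠ p.2),
              (β / Real.sqrt (2 * (L : ℝ) ^ d)) * J p * spin σ p.1 * spin σ p.2))
          ∂(Measure.pi fun _ : Fin (L ^ d) × Fin (L ^ d) =>
              gaussianReal (β / Real.sqrt (2 * (L : ℝ) ^ d)) 1))
      atTop (𝓝 (rsFunctional β q)) := by
  have h := (sk_limit β _ q hβ hq rfl hmax).comp (tendsto_pow_atTop (α := ℕ) hd.ne')
  refine h.congr fun L => ?_
  simp only [Function.comp_apply, skTarget, Nat.cast_pow]
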